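/- Let 1 < γ₀ < 2, R ≥ 2, n ≤ 3, and let φ be a smooth function of (t,x) on a neighborhood of {t = 0, r ≥ R} with 𝓔_{n,γ₀} < ∞. Then there is a universal constant C such that on {t=0, r ≥ R}: (i) ∫_{S_r} r^{1+γ₀−2ζ(Z^i)} |Z^{(i)}φ|² dω ≤ C 𝓔_{i,γ₀} for every product Z^i with i ≤ n, where S_r = {t=0, |x|=r}; (ii) ∫_{S_r} r^{2+2γ₀−4ζ(Z^i)} |Z^{(i)}φ|⁴ dω ≤ C 𝓔²_{i,γ₀} for i ≤ n; (iii) for −ū₁ ≤ u₁ ≤ u₀(M₀), ∫_{Σ₀^{u₁,ū₁}} r^{−1−2ζ(Z^i)} |Z^{(i)}φ|² dx ≤ C (u₁)₊^{−γ₀+1} 𝓔_{i−1,γ₀} for i ≤ n+1; (iv) the pointwise bound r² |Z^{(i−1)}φ(u,−u,ω)|² ≤ C u₊^{−γ₀+1+2ζ(Z^{i−1})} 𝓔_{i,γ₀} holds on {t=0, r ≥ R} for i ≤ n. -/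

import Mathlib

open MeasureTheory Real Set

noncomputable section

namespace ExtStab

/-- Euclidean 3-space. -/
abbrev E3 := EuclideanSpace ℝ (Fin 3)
/-- Minkowski spacetime `ℝ^{1+3}`, as time × space. -/
abbrev Spt := ℝ × E3

/-- The spatial radius `r = |x|`. -/
def rr (p : Spt) : ℝ := ‖p.2‖

/-- The coordinate direction `∂_μ` as a vector. -/
def coordVec (μ : Fin 4) : Spt :=
  if _ : μ.1 = 0 then ((1 : ℝ), 0)
  else (0, EuclideanSpace.single ⟨μ.1 - 1, by have := μ.2; omega⟩ 1)

/-- Spacetime coordinate functions `x^μ`. -/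
def Xc (μ : Fin 4) (p : Spt) : ℝ :=
  if _ : μ.1 = 0 then p.1 else p.2 ⟨μ.1 - 1, by have := μ.2; omega⟩

/-- The Minkowski metric (and its inverse), signature `(-+++ )`. -/
def η (μ ν : Fin 4) : ℝ := if μ = ν then (if μ = 0 then -1 else 1) else 0

/-- coordinate derivative `∂_μ f`. -/
def pderiv (μ : Fin 4) (f : Spt → ℝ) (p : Spt) : ℝ := fderiv ℝ f p (coordVec μ)

/-- `∂_t f`. -/
def dt (f : Spt → ℝ) (p : Spt) : ℝ := fderiv ℝ f p (1, 0)
/-- spatial coordinate derivative `∂_i f`. -/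
def dx (i : Fin 3) (f : Spt → ℝ) (p : Spt) : ℝ := fderiv ℝ f p (0, EuclideanSpace.single i 1)
/-- radial derivative `∂_r f`. -/
def dr (f : Spt → ℝ) (p : Spt) : ℝ := fderiv ℝ f p (0, ‖p.2‖⁻¹ • p.2)
/-- `L = ∂_t + ∂_r`. -/
def Lop (f : Spt → ℝ) (p : Spt) : ℝ := fderiv ℝ f p (1, ‖p.2‖⁻¹ • p.2)
/-- `L̄ = ∂_t − ∂_r`. -/
def Lbop (f : Spt → ℝ) (p : Spt) : ℝ := fderiv ℝ f p (1, -(‖p.2‖⁻¹ • p.2))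
/-- angular derivative `∇_i = ∂_i − (x^i/r)∂_r`. -/
def slash (i : Fin 3) (f : Spt → ℝ) (p : Spt) : ℝ := dx i f p - (p.2 i / ‖p.2‖) * dr f p
/-- rotation `Ω_{ij} = x^i∂_j − x^j∂_i`. -/
def rot (i j : Fin 3) (f : Spt → ℝ) (p : Spt) : ℝ := p.2 i * dx j f p - p.2 j * dx i f p

/-- `|∇f|²`. -/
def gradSq (f : Spt → ℝ) (p : Spt) : ℝ := ∑ i, (slash i f p) ^ 2
/-- `|∂f|` (sum of absolute values of all coordinate derivatives). -/
def pdAbs (f : Spt → ℝ) (p : Spt) : ℝ := ∑ μ, |pderiv μ f p|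
/-- `|∂̲f| = |(L̄f, ∇f)|`. -/
def udAbs (f : Spt → ℝ) (p : Spt) : ℝ := |Lbop f p| + ∑ i, |slash i f p|
/-- `|∂f|²`. -/
def pdSq (f : Spt → ℝ) (p : Spt) : ℝ := ∑ μ, (pderiv μ f p) ^ 2

/-- the Minkowski wave operator `□_m = m^{μν}∂_μ∂_ν = −∂_t² + Δ`. -/
def boxm (f : Spt → ℝ) (p : Spt) : ℝ := ∑ μ, ∑ ν, η μ ν * pderiv μ (pderiv ν f) p

/-- the function `r·f`. -/
def rmul (f : Spt → ℝ) : Spt → ℝ := fun p => rr p * f p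

/-- `r_*(M₀,r) = r − 2M₀ log((r+M₀)/(1+M₀))`. -/
def rstar (M₀ r : ℝ) : ℝ := r - 2 * M₀ * Real.log ((r + M₀) / (1 + M₀))
/-- the optical function `u = t − r_*(M₀,r)`. -/
def uu (M₀ : ℝ) (p : Spt) : ℝ := p.1 - rstar M₀ ‖p.2‖
/-- the optical function `ū = t + r_*(M₀,r)`. -/
def ubar (M₀ : ℝ) (p : Spt) : ℝ := p.1 + rstar M₀ ‖p.2‖
/-- `u₀(M₀) = −r_*(M₀,R)`. -/
def u0 (M₀ R : ℝ) : ℝ := - rstar M₀ R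
/-- the inverse function of `r ↦ r_*(M₀,r)`. -/
def rOf (M₀ : ℝ) : ℝ → ℝ := Function.invFun (rstar M₀)
/-- the spacetime point with coordinates `(u, ū, ω)`. -/
def pt (M₀ uval vval : ℝ) (ω : E3) : Spt :=
  ((vval + uval) / 2, (rOf M₀ ((vval - uval) / 2)) • ω)

/-- the unit sphere in `E3`. -/
def sphere1 : Set E3 := Metric.sphere (0 : E3) 1

/-- integral over the unit sphere with the standard surface measure `dω`. -/
def sphI (g : E3 → ℝ) : ℝ := ∫ ω in sphere1, g ω ∂μH[2]

/-- integral over the truncated outgoing cone `H_u`, `ū' ∈ [lo, hi]`, measure `dū'dω`. -/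
def intH (M₀ uval lo hi : ℝ) (g : Spt → ℝ) : ℝ :=
  ∫ v in Icc lo hi, sphI (fun ω => g (pt M₀ uval v ω))

/-- integral over the truncated incoming cone `H̄_ū`, `u' ∈ [lo, hi]`, measure `du'dω`. -/
def intHb (M₀ vval lo hi : ℝ) (g : Spt → ℝ) : ℝ :=
  ∫ uval in Icc lo hi, sphI (fun ω => g (pt M₀ uval vval ω))

/-- integral over the sphere `S_{u,ū}` with the unit-sphere measure `dω`. -/
def sphS (M₀ uval vval : ℝ) (g : Spt → ℝ) : ℝ := sphI (fun ω => g (pt M₀ uval vval ω))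

/-- energy density on outgoing cones. -/
def eDH (M : ℝ) (q : E3 → ℝ) (f : Spt → ℝ) (p : Spt) : ℝ :=
  (1/2) * rr p ^ 2 *
    ((Lop f p) ^ 2 + (M / rr p) * (Lbop f p) ^ 2 + gradSq f p + q p.2 * (f p) ^ 2)

/-- energy density on incoming cones. -/
def eDHb (M : ℝ) (q : E3 → ℝ) (f : Spt → ℝ) (p : Spt) : ℝ :=
  (1/2) * rr p ^ 2 *
    ((Lbop f p) ^ 2 + (M / rr p) * (Lop f p) ^ 2 + gradSq f p + q p.2 * (f p) ^ 2)

/-- `E[f](H_u^ū)`. -/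
def energyH (M₀ M : ℝ) (q : E3 → ℝ) (f : Spt → ℝ) (uval vval : ℝ) : ℝ :=
  intH M₀ uval (-uval) vval (eDH M q f)

/-- `E[f](H̄_ū^u)`. -/
def energyHb (M₀ M : ℝ) (q : E3 → ℝ) (f : Spt → ℝ) (vval uval : ℝ) : ℝ :=
  intHb M₀ vval (-vval) uval (eDHb M q f)

/-- weighted energy density on outgoing cones. -/
def wDH (M : ℝ) (q : E3 → ℝ) (f : Spt → ℝ) (p : Spt) : ℝ :=
  (1/2) * (rr p * (Lop (rmul f) p) ^ 2 + M * rr p ^ 2 * (gradSq f p + q p.2 * (f p) ^ 2))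

/-- weighted energy density on incoming cones. -/
def wDHb (M : ℝ) (q : E3 → ℝ) (f : Spt → ℝ) (p : Spt) : ℝ :=
  (1/2) * (rr p ^ 3 * (gradSq f p + q p.2 * (f p) ^ 2) + M * rr p ^ 2 * (Lop f p) ^ 2)

/-- `W₁[f](H_u^ū)`. -/
def w1H (M₀ M : ℝ) (q : E3 → ℝ) (f : Spt → ℝ) (uval vval : ℝ) : ℝ :=
  intH M₀ uval (-uval) vval (wDH M q f)

/-- `W₁[f](H̄_ū^u)`. -/
def w1Hb (M₀ M : ℝ) (q : E3 → ℝ) (f : Spt → ℝ) (vval uval : ℝ) : ℝ :=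
  intHb M₀ vval (-vval) uval (wDHb M q f)

/-- the spacetime region `D_u^ū = {−ū ≤ −ū' ≤ u' ≤ u}`. -/
def Dreg (M₀ uval vval : ℝ) : Set Spt :=
  {p | -vval ≤ -ubar M₀ p ∧ -ubar M₀ p ≤ uu M₀ p ∧ uu M₀ p ≤ uval}

/-- `W₁[f](D_u^ū)` (spacetime measure). -/
def w1D (M₀ : ℝ) (f : Spt → ℝ) (uval vval : ℝ) : ℝ :=
  ∫ p in Dreg M₀ uval vval, (((rr p) ^ 2)⁻¹ * (Lop (rmul f) p) ^ 2 + gradSq f p)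

/-- the initial region `Σ₀^{u,ū} = {t = 0, −ū ≤ u' ≤ u}` (as a subset of `E3`). -/
def Sigma0 (M₀ uval vval : ℝ) : Set E3 :=
  {x | -vval ≤ -rstar M₀ ‖x‖ ∧ -rstar M₀ ‖x‖ ≤ uval}

/-- `E[f](Σ₀^{u,ū})`. -/
def energy0 (M₀ : ℝ) (q : E3 → ℝ) (f : Spt → ℝ) (uval vval : ℝ) : ℝ :=
  ∫ x in Sigma0 M₀ uval vval, (pdSq f (0, x) + q x * (f (0, x)) ^ 2)

/-- `W₁[f](Σ₀^{u,ū})`. -/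
def w10 (M₀ : ℝ) (q : E3 → ℝ) (f : Spt → ℝ) (uval vval : ℝ) : ℝ :=
  ∫ x in Sigma0 M₀ uval vval,
    (‖x‖⁻¹ * (Lop (rmul f) (0, x)) ^ 2 + ‖x‖ * (gradSq f (0, x) + q x * (f (0, x)) ^ 2))

/-- the commuting vector fields `Z ∈ {Ω_{ij}, ∂_μ}`. -/
inductive VF : Type
  | rot (i j : Fin 3) : VF
  | pd (μ : Fin 4) : VF
  deriving DecidableEq

/-- a vector field applied to a function. -/
def VF.app : VF → (Spt → ℝ) → Spt → ℝ
  | .rot i j, f => ExtStab.rot i j f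
  | .pd μ, f => pderiv μ f

/-- the signature `ζ(Z)`. -/
def VF.zeta : VF → ℤ
  | .rot _ _ => 0
  | .pd _ => -1

/-- the `n`-th order operator `Z^{(n)}` associated to an ordered product `Z^n = Z₁⋯Z_n`. -/
def Zop : List VF → (Spt → ℝ) → Spt → ℝ
  | [], f => f
  | Z :: l, f => Z.app (Zop l f)

/-- the signature `ζ(Z^n)` of a product. -/
def zeta (l : List VF) : ℤ := (l.map VF.zeta).sum

/-- all splittings `Z^a ⊔ Z^b = Z^n` of a product into two disjoint ordered subproducts. -/
def sp2 : List VF → List (List VF × List VF)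
  | [] => [([], [])]
  | z :: l => (sp2 l).map (fun p => (z :: p.1, p.2)) ++ (sp2 l).map (fun p => (p.1, z :: p.2))

/-- all splittings `Z^a ⊔ Z^b ⊔ Z^c = Z^n`. -/
def sp3 (l : List VF) : List (List VF × List VF × List VF) :=
  (sp2 l).flatMap (fun p => (sp2 p.2).map (fun q => (p.1, q.1, q.2)))

/-- all splittings `Z^a ⊔ Z^b ⊔ Z^c ⊔ Z^d = Z^n`. -/
def sp4 (l : List VF) : List (List VF × List VF × List VF × List VF) :=
  (sp2 l).flatMap (fun p => (sp3 p.2).map (fun q => (p.1, q)))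

/-- the index set of the rotation fields `Ω_{ij}`, `1 ≤ i < j ≤ 3`. -/
def rotIdx : Finset (Fin 3 × Fin 3) := Finset.univ.filter (fun ij => ij.1 < ij.2)

/-- `‖iteratedFDeriv‖` for data on `E3`. -/
def idfN (l : ℕ) (g : E3 → ℝ) (x : E3) : ℝ := ‖iteratedFDeriv ℝ l g x‖

/-- the weighted data norm `𝓔_{k,γ₀,R,q₀}` of an initial data set `(φ₀,φ₁)`. -/
def dataNorm (k : ℕ) (γ₀ R q₀ : ℝ) (φ₀ φ₁ : E3 → ℝ) : ℝ :=
  (∫ x in {x : E3 | R ≤ ‖x‖}, (1 + ‖x‖) ^ (γ₀ - 2) * (φ₀ x) ^ 2)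
  + ∑ l ∈ Finset.range (k + 1),
      ∫ x in {x : E3 | R ≤ ‖x‖},
        (1 + ‖x‖) ^ (γ₀ + 2 * (l : ℝ)) *
          ((idfN (l + 1) φ₀ x) ^ 2 + (idfN l φ₁ x) ^ 2 + q₀ * (idfN l φ₀ x) ^ 2)

/-- finiteness (integrability) of the weighted data norm. -/
def DataFinite (k : ℕ) (γ₀ R q₀ : ℝ) (φ₀ φ₁ : E3 → ℝ) : Prop :=
  IntegrableOn (fun x : E3 => (1 + ‖x‖) ^ (γ₀ - 2) * (φ₀ x) ^ 2) {x : E3 | R ≤ ‖x‖} ∧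
  ∀ l ≤ k, IntegrableOn
    (fun x : E3 => (1 + ‖x‖) ^ (γ₀ + 2 * (l : ℝ)) *
      ((idfN (l + 1) φ₀ x) ^ 2 + (idfN l φ₁ x) ^ 2 + q₀ * (idfN l φ₀ x) ^ 2))
    {x : E3 | R ≤ ‖x‖}

/-- `‖iteratedFDeriv‖` for spacetime functions. -/
def idfNST (l : ℕ) (g : Spt → ℝ) (p : Spt) : ℝ := ‖iteratedFDeriv ℝ l g p‖

/-- the weighted data norm of `φ[0]`, with all spacetime derivatives at `t = 0`. -/
def dataNormST (k : ℕ) (γ₀ R q₀ : ℝ) (φ : Spt → ℝ) : ℝ :=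
  (∫ x in {x : E3 | R ≤ ‖x‖}, (1 + ‖x‖) ^ (γ₀ - 2) * (φ (0, x)) ^ 2)
  + ∑ l ∈ Finset.range (k + 1),
      ∫ x in {x : E3 | R ≤ ‖x‖},
        (1 + ‖x‖) ^ (γ₀ + 2 * (l : ℝ)) *
          ((idfNST (l + 1) φ (0, x)) ^ 2 + q₀ * (idfNST l φ (0, x)) ^ 2)

/-- finiteness (integrability) of the spacetime weighted data norm. -/
def DataFiniteST (k : ℕ) (γ₀ R q₀ : ℝ) (φ : Spt → ℝ) : Prop :=
  IntegrableOn (fun x : E3 => (1 + ‖x‖) ^ (γ₀ - 2) * (φ (0, x)) ^ 2) {x : E3 | R ≤ ‖x‖} ∧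
  ∀ l ≤ k, IntegrableOn
    (fun x : E3 => (1 + ‖x‖) ^ (γ₀ + 2 * (l : ℝ)) *
      ((idfNST (l + 1) φ (0, x)) ^ 2 + q₀ * (idfNST l φ (0, x)) ^ 2))
    {x : E3 | R ≤ ‖x‖}

/-- the potential assumption: `q : ℝ³ → [0,1]` smooth with `|r^i ∂^{(i)}q| ≲ r^{−2−η}`, `1 ≤ i ≤ n`. -/
def PotAssum (n : ℕ) (q : E3 → ℝ) : Prop :=
  ContDiff ℝ (⊤ : ℕ∞) q ∧ (∀ x, 0 ≤ q x ∧ q x ≤ 1) ∧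
  ∃ ηc > (0 : ℝ), ∃ C > (0 : ℝ), ∀ i : ℕ, 1 ≤ i → i ≤ n → ∀ x : E3, x ≠ 0 →
    ‖x‖ ^ (i : ℝ) * ‖iteratedFDeriv ℝ i q x‖ ≤ C * ‖x‖ ^ (-(2 : ℝ) - ηc)

/-- the bootstrap assumption `(BA_n)` on the region `{−ū_* ≤ −ū ≤ u ≤ u₀(M₀,R)}`. -/
def BA (M₀ M : ℝ) (q : E3 → ℝ) (γ₀ δ ubst R : ℝ) (n : ℕ) (φ : Spt → ℝ) : Prop :=
  ∀ Zl : List VF, Zl.length ≤ n → ∀ uval vval : ℝ,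
    -ubst ≤ -vval → -vval ≤ uval → uval ≤ u0 M₀ R →
      (energyH M₀ M q (Zop Zl φ) uval vval + energyHb M₀ M q (Zop Zl φ) vval uval
        ≤ 2 * δ * (-uval) ^ (-γ₀ + 2 * (zeta Zl : ℝ))) ∧
      (w1H M₀ M q (Zop Zl φ) uval vval + w1Hb M₀ M q (Zop Zl φ) vval uval
          + w1D M₀ (Zop Zl φ) uval vval
        ≤ 2 * δ * (-uval) ^ (-γ₀ + 1 + 2 * (zeta Zl : ℝ)))

/-- `∫_ω |F|² dω` on `S_{u,ū}`. -/
def sphL2 (M₀ : ℝ) (F : Spt → ℝ) (uval vval : ℝ) : ℝ := sphS M₀ uval vval (fun p => (F p) ^ 2)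
/-- `∫_ω |F|⁴ dω` on `S_{u,ū}`. -/
def sphL4 (M₀ : ℝ) (F : Spt → ℝ) (uval vval : ℝ) : ℝ := sphS M₀ uval vval (fun p => (F p) ^ 4)

/-- `‖F‖_{L²(D_{u₁}^{ū₁})}` (spacetime measure). -/
def nL2D (M₀ : ℝ) (F : Spt → ℝ) (u1 v1 : ℝ) : ℝ :=
  Real.sqrt (∫ p in Dreg M₀ u1 v1, (F p) ^ 2)
/-- `‖F‖_{L¹_ū L²_u L²_ω(D_{u₁}^{ū₁})}`. -/
def nL1ubL2uL2o (M₀ : ℝ) (F : Spt → ℝ) (u1 v1 : ℝ) : ℝ :=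
  ∫ v in Icc (-u1) v1, Real.sqrt (∫ uval in Icc (-v) u1, sphL2 M₀ F uval v)
/-- `‖F‖_{L¹_u L²_ū L²_ω(D_{u₁}^{ū₁})}`. -/
def nL1uL2ubL2o (M₀ : ℝ) (F : Spt → ℝ) (u1 v1 : ℝ) : ℝ :=
  ∫ uval in Icc (-v1) u1, Real.sqrt (∫ v in Icc (-uval) v1, sphL2 M₀ F uval v)
/-- `‖F‖_{L²_u L⁴_ω(H̄_{ū₁}^{u₁})}`. -/
def nL2uL4oHb (M₀ : ℝ) (F : Spt → ℝ) (v1 u1 : ℝ) : ℝ :=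
  Real.sqrt (∫ uval in Icc (-v1) u1, Real.sqrt (sphL4 M₀ F uval v1))
/-- `‖F‖_{L²_u L²_ū L⁴_ω(D_{u₁}^{ū₁})}`. -/
def nL2uL2ubL4o (M₀ : ℝ) (F : Spt → ℝ) (u1 v1 : ℝ) : ℝ :=
  Real.sqrt (∫ uval in Icc (-v1) u1, ∫ v in Icc (-uval) v1, Real.sqrt (sphL4 M₀ F uval v))
/-- `‖F‖_{L²_ū L²_u L⁴_ω(D_{u₁}^{ū₁})}`. -/
def nL2ubL2uL4o (M₀ : ℝ) (F : Spt → ℝ) (u1 v1 : ℝ) : ℝ :=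
  Real.sqrt (∫ v in Icc (-u1) v1, ∫ uval in Icc (-v) u1, Real.sqrt (sphL4 M₀ F uval v))
/-- `‖F‖_{L^∞_ū L²_u L⁴_ω(D_{u₁}^{ū₁})}`. -/
def nLinfubL2uL4o (M₀ : ℝ) (F : Spt → ℝ) (u1 v1 : ℝ) : ℝ :=
  ⨆ v ∈ Icc (-u1) v1, Real.sqrt (∫ uval in Icc (-v) u1, Real.sqrt (sphL4 M₀ F uval v))
/-- `‖F‖_{L²_u L^∞_ū L⁴_ω(D_{u₁}^{ū₁})}`. -/
def nL2uLinfubL4o (M₀ : ℝ) (F : Spt → ℝ) (u1 v1 : ℝ) : ℝ :=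
  Real.sqrt (∫ uval in Icc (-v1) u1,
    (⨆ v ∈ Icc (-uval) v1, (sphL4 M₀ F uval v) ^ ((4 : ℝ)⁻¹)) ^ 2)
/-- `‖F‖_{L²_ū L^∞_u L⁴_ω(D_{u₁}^{ū₁})}`. -/
def nL2ubLinfuL4o (M₀ : ℝ) (F : Spt → ℝ) (u1 v1 : ℝ) : ℝ :=
  Real.sqrt (∫ v in Icc (-u1) v1,
    (⨆ uval ∈ Icc (-v) u1, (sphL4 M₀ F uval v) ^ ((4 : ℝ)⁻¹)) ^ 2)
/-- `‖F‖_{L²_ū L^∞(D_{u₁}^{ū₁})}`. -/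
def nL2ubLinf (M₀ : ℝ) (F : Spt → ℝ) (u1 v1 : ℝ) : ℝ :=
  Real.sqrt (∫ v in Icc (-u1) v1,
    (⨆ uval ∈ Icc (-v) u1, ⨆ ω ∈ sphere1, |F (pt M₀ uval v ω)|) ^ 2)
/-- `‖F‖_{L⁴_ω(S_{u,ū})}`. -/
def nL4oS (M₀ : ℝ) (F : Spt → ℝ) (uval vval : ℝ) : ℝ := (sphL4 M₀ F uval vval) ^ ((4 : ℝ)⁻¹)

/-- `E[Ω^{(≤1)}ψ](H_u^ū)`. -/
def energyHrot1 (M₀ M : ℝ) (q : E3 → ℝ) (f : Spt → ℝ) (uval vval : ℝ) : ℝ :=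
  energyH M₀ M q f uval vval + ∑ ij ∈ rotIdx, energyH M₀ M q (rot ij.1 ij.2 f) uval vval

/-- `E[Ω^{(≤1)}ψ](H̄_ū^u)`. -/
def energyHbrot1 (M₀ M : ℝ) (q : E3 → ℝ) (f : Spt → ℝ) (vval uval : ℝ) : ℝ :=
  energyHb M₀ M q f vval uval + ∑ ij ∈ rotIdx, energyHb M₀ M q (rot ij.1 ij.2 f) vval uval

/-- `L′ = L − hL̄`. -/
def Lp (M₀ : ℝ) (f : Spt → ℝ) (p : Spt) : ℝ := Lop f p - (M₀ / rr p) * Lbop f p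
/-- `L̄′ = L̄ − hL`. -/
def Lbp (M₀ : ℝ) (f : Spt → ℝ) (p : Spt) : ℝ := Lbop f p - (M₀ / rr p) * Lop f p

/-- `r^γ · f` (real power weight). -/
def rpw (γ : ℝ) (f : Spt → ℝ) : Spt → ℝ := fun p => rr p ^ γ * f p


/-- `q₀ = sup_{|x| ≥ R} q`. -/
def qsup (R : ℝ) (q : E3 → ℝ) : ℝ := sSup (q '' {x : E3 | R ≤ ‖x‖})

/-- the interval measure on `[-1,1]`. -/
def mI : Measure ℝ := volume.restrict (Icc (-1) 1)
/-- the interval measure on `[1,2]`. -/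
def mJ : Measure ℝ := volume.restrict (Icc 1 2)
/-- measure on the square. -/
def mQ : Measure (ℝ × ℝ) := mI.prod mI

instance : IsFiniteMeasure mI := by unfold mI; infer_instance
instance : IsFiniteMeasure mJ := by unfold mJ; infer_instance
instance : IsFiniteMeasure mQ := by unfold mQ; infer_instance

lemma mQ_eq : mQ = volume.restrict (Icc (-1) 1 ×ˢ Icc (-1) 1) := by
  unfold mQ mI
  rw [Measure.prod_restrict]; rfl

lemma mJQ_eq : mJ.prod mQ = volume.restrict (Icc 1 2 ×ˢ (Icc (-1) 1 ×ˢ Icc (-1) 1)) := by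
  rw [mQ_eq]; unfold mJ
  rw [Measure.prod_restrict]; rfl

lemma ae_mI : ∀ᵐ x ∂mI, x ∈ Icc (-1 : ℝ) 1 := ae_restrict_mem measurableSet_Icc
lemma ae_mJ : ∀ᵐ x ∂mJ, x ∈ Icc (1 : ℝ) 2 := ae_restrict_mem measurableSet_Icc
lemma ae_mQ : ∀ᵐ x ∂mQ, x ∈ Icc (-1 : ℝ) 1 ×ˢ Icc (-1 : ℝ) 1 := by
  rw [mQ_eq]; exact ae_restrict_mem (measurableSet_Icc.prod measurableSet_Icc)
lemma ae_mJQ : ∀ᵐ x ∂(mJ.prod mQ), x ∈ Icc (1 : ℝ) 2 ×ˢ (Icc (-1 : ℝ) 1 ×ˢ Icc (-1 : ℝ) 1) := by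
  rw [mJQ_eq]
  exact ae_restrict_mem (measurableSet_Icc.prod (measurableSet_Icc.prod measurableSet_Icc))

lemma int_mI {f : ℝ → ℝ} (hf : Continuous f) : Integrable f mI :=
  hf.continuousOn.integrableOn_compact isCompact_Icc
lemma int_mJ {f : ℝ → ℝ} (hf : Continuous f) : Integrable f mJ :=
  hf.continuousOn.integrableOn_compact isCompact_Icc
lemma int_mQ {f : ℝ × ℝ → ℝ} (hf : Continuous f) : Integrable f mQ := by
  rw [mQ_eq]; exact hf.continuousOn.integrableOn_compact (isCompact_Icc.prod isCompact_Icc)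
lemma int_mJQ {f : ℝ × ℝ × ℝ → ℝ} (hf : Continuous f) : Integrable f (mJ.prod mQ) := by
  rw [mJQ_eq]
  exact hf.continuousOn.integrableOn_compact
    (isCompact_Icc.prod (isCompact_Icc.prod isCompact_Icc))

lemma sup1d {c d : ℝ} (hcd : c + 1 ≤ d) {k k' K : ℝ → ℝ} (hk : ∀ x, HasDerivAt k (k' x) x)
    (hk' : Continuous k') (hK : Continuous K) (hb : ∀ x ∈ Icc c d, |k x| + |k' x| ≤ K x)
    {x : ℝ} (hx : x ∈ Icc c d) : |k x| ≤ ∫ y in Icc c d, K y := by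
  have hkc : Continuous k := continuous_iff_continuousAt.2 fun x => (hk x).continuousAt
  obtain ⟨y, hy, hmin⟩ := isCompact_Icc.exists_isMinOn ⟨x, hx⟩ (hkc.abs.continuousOn (s := Icc c d))
  have i1 : IntegrableOn (fun y => |k y|) (Icc c d) :=
    hkc.abs.continuousOn.integrableOn_compact isCompact_Icc
  have i2 : IntegrableOn (fun y => |k' y|) (Icc c d) :=
    hk'.abs.continuousOn.integrableOn_compact isCompact_Icc
  have i3 : IntegrableOn K (Icc c d) := hK.continuousOn.integrableOn_compact isCompact_Icc
  have h1 : |k y| ≤ ∫ z in Icc c d, |k z| := by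
    have : ∫ z in Icc c d, |k y| ≤ ∫ z in Icc c d, |k z| :=
      setIntegral_mono_on (by simp) i1 measurableSet_Icc (fun z hz => hmin hz)
    have e : ∫ z in Icc c d, |k y| = (d - c) * |k y| := by
      simp [Measure.real, Real.volume_Icc, ENNReal.toReal_ofReal (show 0 ≤ d - c by linarith)]
    rw [e] at this
    nlinarith [abs_nonneg (k y)]
  have h2 : |k x - k y| ≤ ∫ z in Icc c d, |k' z| := by
    have e := intervalIntegral.integral_eq_sub_of_hasDerivAt (a := y) (b := x)
      (fun z _ => hk z) (hk'.intervalIntegrable _ _)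
    rw [← e]
    have := intervalIntegral.norm_integral_le_integral_norm_uIoc (f := k') (a := y) (b := x)
      (μ := volume)
    simp only [Real.norm_eq_abs] at this
    refine this.trans (setIntegral_mono_set i2 (by filter_upwards with z; positivity) ?_)
    refine LE.le.eventuallyLE ?_
    exact uIoc_subset_uIcc.trans (uIcc_subset_Icc hy hx)
  have h3 : (∫ z in Icc c d, |k z|) + ∫ z in Icc c d, |k' z| ≤ ∫ z in Icc c d, K z := by
    rw [← integral_add i1 i2]
    exact setIntegral_mono_on (i1.add i2) i3 measurableSet_Icc hb
  have : |k x| ≤ |k y| + |k x - k y| := by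
    have := abs_add_le (k y) (k x - k y); simpa using this
  linarith

lemma sob2d {k k1 k2 K : ℝ × ℝ → ℝ} (h1 : ∀ a b, HasDerivAt (fun a => k (a, b)) (k1 (a, b)) a)
    (h2 : ∀ a b, HasDerivAt (fun b => k (a, b)) (k2 (a, b)) b) (hk : Continuous k)
    (hk1 : Continuous k1) (hk2 : Continuous k2) (hK : Continuous K)
    (hb1 : ∀ p ∈ Icc (-1 : ℝ) 1 ×ˢ Icc (-1 : ℝ) 1, |k p| + |k1 p| ≤ K p)
    (hb2 : ∀ p ∈ Icc (-1 : ℝ) 1 ×ˢ Icc (-1 : ℝ) 1, |k p| + |k2 p| ≤ K p) :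
    ∫ p, (k p) ^ 2 ∂mQ ≤ (∫ p, K p ∂mQ) ^ 2 := by
  have iK := int_mQ hK
  have hA : ∀ p ∈ Icc (-1 : ℝ) 1 ×ˢ Icc (-1 : ℝ) 1, |k p| ≤ ∫ a, K (a, p.2) ∂mI := by
    rintro ⟨a, b⟩ ⟨ha, hb⟩
    exact sup1d (by norm_num) (fun a => h1 a b) (by fun_prop) (K := fun a => K (a, b))
      (by fun_prop) (fun a ha => hb1 (a, b) ⟨ha, hb⟩) ha
  have hB : ∀ p ∈ Icc (-1 : ℝ) 1 ×ˢ Icc (-1 : ℝ) 1, |k p| ≤ ∫ b, K (p.1, b) ∂mI := by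
    rintro ⟨a, b⟩ ⟨ha, hb⟩
    exact sup1d (by norm_num) (fun b => h2 a b) (by fun_prop) (K := fun b => K (a, b))
      (by fun_prop) (fun b hb => hb2 (a, b) ⟨ha, hb⟩) hb
  have e1 : ∫ p, K p ∂mQ = ∫ a, ∫ b, K (a, b) ∂mI ∂mI := integral_prod _ iK
  have e2 : ∫ p, K p ∂mQ = ∫ b, ∫ a, K (a, b) ∂mI ∂mI := integral_prod_symm _ iK
  have e3 := integral_prod_mul (μ := mI) (ν := mI) (fun a => ∫ b, K (a, b) ∂mI)
    (fun b => ∫ a, K (a, b) ∂mI)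
  rw [← e1, ← e2] at e3
  rw [sq, ← e3]
  refine integral_mono_ae (int_mQ (by fun_prop)) ?_ ?_
  · exact (Integrable.integral_prod_left iK).mul_prod (Integrable.integral_prod_right iK)
  · filter_upwards [ae_mQ] with p hp
    have := hA p hp
    have := hB p hp
    rw [← sq_abs, sq]
    gcongr
    exact (abs_nonneg _).trans this

lemma cs {α : Type*} [MeasurableSpace α] {μ : Measure α} {f g : α → ℝ}
    (hf : Integrable (fun x => f x ^ 2) μ) (hg : Integrable (fun x => g x ^ 2) μ)
    (hfg : Integrable (fun x => f x * g x) μ) :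
    (∫ x, f x * g x ∂μ) ^ 2 ≤ (∫ x, f x ^ 2 ∂μ) * ∫ x, g x ^ 2 ∂μ := by
  have : ∀ t : ℝ, 0 ≤ (∫ x, g x ^ 2 ∂μ) * (t * t) + (2 * ∫ x, f x * g x ∂μ) * t +
      ∫ x, f x ^ 2 ∂μ := by
    intro t
    have e : ∫ x, (f x + t * g x) ^ 2 ∂μ = (∫ x, g x ^ 2 ∂μ) * (t * t) +
        (2 * ∫ x, f x * g x ∂μ) * t + ∫ x, f x ^ 2 ∂μ := by
      have : ∀ x, (f x + t * g x) ^ 2 = (t * t) * g x ^ 2 + (2 * t) * (f x * g x) + f x ^ 2 := by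
        intro x; ring
      simp_rw [this]
      rw [integral_add (f := fun x => (t * t) * g x ^ 2 + (2 * t) * (f x * g x)) ((hg.const_mul _).add (hfg.const_mul _)) hf,
        integral_add (hg.const_mul _) (hfg.const_mul _), integral_const_mul, integral_const_mul]
      ring
    rw [← e]
    exact integral_nonneg fun x => sq_nonneg _
  have := discrim_le_zero this
  unfold discrim at this
  nlinarith

lemma cont_param {F : ℝ × ℝ × ℝ → ℝ} (hF : Continuous F) :
    Continuous (fun s => ∫ q, F (s, q) ∂mQ) := by
  rw [mQ_eq]
  exact continuous_parametric_integral_of_continuous (f := fun s q => F (s, q)) (by fun_prop)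
    (isCompact_Icc.prod isCompact_Icc)

lemma dpow2 {f : ℝ → ℝ} {f' x : ℝ} (h : HasDerivAt f f' x) :
    HasDerivAt (fun y => f y ^ 2) (2 * f x * f') x := by
  have := h.fun_pow 2; norm_num at this; exact this
lemma dpow3 {f : ℝ → ℝ} {f' x : ℝ} (h : HasDerivAt f f' x) :
    HasDerivAt (fun y => f y ^ 3) (3 * f x ^ 2 * f') x := by
  have := h.fun_pow 3; norm_num at this; exact this
lemma dpow4 {f : ℝ → ℝ} {f' x : ℝ} (h : HasDerivAt f f' x) :
    HasDerivAt (fun y => f y ^ 4) (4 * f x ^ 3 * f') x := by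
  have := h.fun_pow 4; norm_num at this; exact this

lemma box_est {h h0 h1 h2 w : ℝ × ℝ × ℝ → ℝ}
    (d0 : ∀ s q, HasDerivAt (fun s => h (s, q)) (h0 (s, q)) s)
    (d1 : ∀ s a b, HasDerivAt (fun a => h (s, a, b)) (h1 (s, a, b)) a)
    (d2 : ∀ s a b, HasDerivAt (fun b => h (s, a, b)) (h2 (s, a, b)) b)
    (ch : Continuous h) (ch0 : Continuous h0) (ch1 : Continuous h1) (ch2 : Continuous h2)
    (cw : Continuous w)
    (bd : ∀ p ∈ Icc (1 : ℝ) 2 ×ˢ (Icc (-1 : ℝ) 1 ×ˢ Icc (-1 : ℝ) 1),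
      |h p| ≤ w p ∧ |h0 p| ≤ w p ∧ |h1 p| ≤ w p ∧ |h2 p| ≤ w p)
    {s₀ : ℝ} (hs₀ : s₀ ∈ Icc (1 : ℝ) 2) :
    ∫ q, h (s₀, q) ^ 4 ∂mQ ≤ (19 * ∫ p, w p ^ 2 ∂(mJ.prod mQ)) ^ 2 := by
  set f : ℝ → ℝ := fun s => ∫ q, h (s, q) ^ 4 ∂mQ with hf
  set n : ℝ → ℝ := fun s => ∫ q, w (s, q) ^ 2 ∂mQ with hn
  set e : ℝ → ℝ := fun s => ∫ q, |h (s, q)| ^ 3 * w (s, q) ∂mQ with he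
  have cf : Continuous f := cont_param (F := fun p => h p ^ 4) (by fun_prop)
  have cn : Continuous n := cont_param (F := fun p => w p ^ 2) (by fun_prop)
  have ce : Continuous e := cont_param (F := fun p => |h p| ^ 3 * w p) (by fun_prop)
  have fnn : ∀ s, 0 ≤ f s := fun s => integral_nonneg fun q => by positivity
  have nnn : ∀ s, 0 ≤ n s := fun s => integral_nonneg fun q => by positivity
  have F1 : ∀ s ∈ Icc (1 : ℝ) 2, f s ≤ 3 * √(f s) * n s := by
    intro s hs
    have : ∫ p, ((fun q => h (s, q) ^ 2) p) ^ 2 ∂mQ ≤ (∫ p, 3 * w (s, p) ^ 2 ∂mQ) ^ 2 := by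
      refine sob2d (k1 := fun q => 2 * h (s, q) * h1 (s, q)) (k2 := fun q => 2 * h (s, q) * h2 (s, q))
        ?_ ?_ (by fun_prop) (by fun_prop) (by fun_prop) (by fun_prop) ?_ ?_
      · intro a b
        exact dpow2 (d1 s a b)
      · intro a b
        exact dpow2 (d2 s a b)
      · intro q hq
        obtain ⟨b0, b1, b2, b3⟩ := bd (s, q) ⟨hs, hq⟩
        have := abs_nonneg (h (s, q))
        have := abs_nonneg (h1 (s, q))
        simp only [abs_mul, abs_pow, abs_two]
        nlinarith [mul_le_mul b0 b2 (by positivity) (by linarith), mul_le_mul b0 b0 (by positivity) (by linarith)]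
      · intro q hq
        obtain ⟨b0, b1, b2, b3⟩ := bd (s, q) ⟨hs, hq⟩
        have := abs_nonneg (h (s, q))
        have := abs_nonneg (h2 (s, q))
        simp only [abs_mul, abs_pow, abs_two]
        nlinarith [mul_le_mul b0 b3 (by positivity) (by linarith), mul_le_mul b0 b0 (by positivity) (by linarith)]
    rw [integral_const_mul] at this
    have e1 : f s ≤ (3 * n s) ^ 2 := by
      convert this using 1
      simp only [hf]; congr 1; ext q; ring
    have e2 : √(f s) ≤ 3 * n s := (Real.sqrt_le_left (by linarith [nnn s])).2 e1
    nlinarith [Real.mul_self_sqrt (fnn s), Real.sqrt_nonneg (f s)]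
  have F2 : ∀ s ∈ Icc (1 : ℝ) 2, e s ≤ 4 * √(f s) * n s := by
    intro s hs
    have s1 : ∫ p, ((fun q => h (s, q) ^ 3) p) ^ 2 ∂mQ ≤ (∫ p, 4 * (h (s, p) ^ 2 * w (s, p)) ∂mQ) ^ 2 := by
      refine sob2d (k1 := fun q => 3 * h (s, q) ^ 2 * h1 (s, q)) (k2 := fun q => 3 * h (s, q) ^ 2 * h2 (s, q))
        ?_ ?_ (by fun_prop) (by fun_prop) (by fun_prop) (by fun_prop) ?_ ?_
      · intro a b
        exact dpow3 (d1 s a b)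
      · intro a b
        exact dpow3 (d2 s a b)
      · intro q hq
        obtain ⟨b0, b1, b2, b3⟩ := bd (s, q) ⟨hs, hq⟩
        have := sq_nonneg (h (s, q))
        simp only [abs_mul, abs_pow, abs_of_nonneg (show (0:ℝ) ≤ 3 by norm_num)]
        rw [pow_succ, sq_abs]
        nlinarith [mul_le_mul_of_nonneg_left b0 this, mul_le_mul_of_nonneg_left b2 this]
      · intro q hq
        obtain ⟨b0, b1, b2, b3⟩ := bd (s, q) ⟨hs, hq⟩
        have := sq_nonneg (h (s, q))
        simp only [abs_mul, abs_pow, abs_of_nonneg (show (0:ℝ) ≤ 3 by norm_num)]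
        rw [pow_succ, sq_abs]
        nlinarith [mul_le_mul_of_nonneg_left b0 this, mul_le_mul_of_nonneg_left b3 this]
    rw [integral_const_mul] at s1
    have s2 := cs (μ := mQ) (f := fun q => h (s, q) ^ 2) (g := fun q => w (s, q))
      (int_mQ (by fun_prop)) (int_mQ (by fun_prop)) (int_mQ (by fun_prop))
    have s3 := cs (μ := mQ) (f := fun q => |h (s, q)| ^ 3) (g := fun q => w (s, q))
      (int_mQ (by fun_prop)) (int_mQ (by fun_prop)) (int_mQ (by fun_prop))
    have t2 : ∫ q, (h (s, q) ^ 2) ^ 2 ∂mQ = f s := by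
      simp only [hf]; congr 1; ext q; ring
    have t3 : ∫ q, (|h (s, q)| ^ 3) ^ 2 ∂mQ = ∫ p, ((fun q => h (s, q) ^ 3) p) ^ 2 ∂mQ := by
      congr 1; ext q; rw [← abs_pow, sq_abs]
    rw [t2] at s2
    rw [t3] at s3
    have s4 : (e s) ^ 2 ≤ (4 * √(f s) * n s) ^ 2 := by
      calc (e s) ^ 2 ≤ _ := s3
        _ ≤ (16 * (f s * n s)) * n s := by
          gcongr ?_ * n s
          refine s1.trans ?_
          rw [mul_pow]
          norm_num
          exact s2
        _ = _ := by
          rw [mul_pow, mul_pow, Real.sq_sqrt (fnn s)]; ring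
    exact (le_abs_self _).trans (abs_le_of_sq_le_sq s4 (by have := nnn s; positivity))
  have F3 : ∀ s₁ ∈ Icc (1 : ℝ) 2, f s₁ ≤ ∫ s, (f s + 4 * e s) ∂mJ := by
    intro s₁ hs₁
    have ci : Continuous (fun p : ℝ × ℝ × ℝ => h p ^ 4 + 4 * (|h p| ^ 3 * w p)) := by fun_prop
    have a1 : ∫ s, (f s + 4 * e s) ∂mJ =
        ∫ q, ∫ s, (h (s, q) ^ 4 + 4 * (|h (s, q)| ^ 3 * w (s, q))) ∂mJ ∂mQ := by
      rw [← integral_prod_symm (fun p : ℝ × ℝ × ℝ => h p ^ 4 + 4 * (|h p| ^ 3 * w p)) (int_mJQ ci),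
        integral_prod _ (int_mJQ ci)]
      congr 1; ext s
      rw [integral_add (int_mQ (by fun_prop)) (int_mQ (by fun_prop)), integral_const_mul]
    rw [a1]
    refine integral_mono_ae (int_mQ (by fun_prop)) ((int_mJQ ci).integral_prod_right) ?_
    filter_upwards [ae_mQ] with q hq
    have := sup1d (c := 1) (d := 2) (by norm_num) (k := fun s => h (s, q) ^ 4)
      (k' := fun s => 4 * h (s, q) ^ 3 * h0 (s, q))
      (K := fun s => h (s, q) ^ 4 + 4 * (|h (s, q)| ^ 3 * w (s, q)))
      (fun s => dpow4 (d0 s q)) (by fun_prop) (by fun_prop) ?_ hs₁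
    · exact (le_abs_self _).trans this
    · intro s hs
      obtain ⟨b0, b1, b2, b3⟩ := bd (s, q) ⟨hs, hq⟩
      rw [abs_of_nonneg (show 0 ≤ h (s, q) ^ 4 by positivity)]
      simp only [abs_mul, abs_pow, abs_of_nonneg (show (0:ℝ) ≤ 4 by norm_num)]
      have : 0 ≤ |h (s, q)| ^ 3 := by positivity
      nlinarith [mul_le_mul_of_nonneg_left b1 this]
  obtain ⟨s₁, hs₁, hmax⟩ := isCompact_Icc.exists_isMaxOn ⟨s₀, hs₀⟩ (cf.continuousOn (s := Icc 1 2))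
  have eN : ∫ p, w p ^ 2 ∂(mJ.prod mQ) = ∫ s, n s ∂mJ := integral_prod _ (int_mJQ (by fun_prop))
  have hN : 0 ≤ ∫ s, n s ∂mJ := integral_nonneg nnn
  have F4 : f s₁ ≤ 19 * √(f s₁) * ∫ s, n s ∂mJ := by
    refine (F3 s₁ hs₁).trans ?_
    rw [← integral_const_mul]
    refine integral_mono_ae (int_mJ (by fun_prop)) (int_mJ (by fun_prop)) ?_
    filter_upwards [ae_mJ] with s hs
    have q1 := F1 s hs
    have q2 := F2 s hs
    have q3 : √(f s) ≤ √(f s₁) := Real.sqrt_le_sqrt (hmax hs)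
    nlinarith [mul_le_mul_of_nonneg_right q3 (nnn s)]
  rw [eN]
  refine (hmax hs₀).trans ?_
  have q0 := Real.sqrt_nonneg (f s₁)
  have q1 := Real.sq_sqrt (fnn s₁)
  rw [← q1]
  have : √(f s₁) ≤ 19 * ∫ s, n s ∂mJ := by
    by_contra hc
    push Not at hc
    have : 0 < √(f s₁) := by linarith
    nlinarith
  gcongr

lemma mI_univ : mI.real univ = 2 := by
  simp [mI, Measure.real, Real.volume_Icc]; norm_num

lemma mQ_univ : mQ.real univ = 4 := by
  have : (univ : Set (ℝ × ℝ)) = univ ×ˢ univ := by simp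
  rw [this, mQ, measureReal_prod_prod, mI_univ]; norm_num

lemma scale1 {v : ℝ → ℝ} (hv : Continuous v) (h0 : ∀ x, 0 ≤ v x) {p t : ℝ}
    (hp : p ∈ Icc (-1 : ℝ) 1) (ht0 : 0 < t) (ht1 : t ≤ 1) :
    ∫ y, v (p + t * (y - p)) ∂mI ≤ t⁻¹ * ∫ y, v y ∂mI := by
  have e1 : ∀ g : ℝ → ℝ, ∫ y, g y ∂mI = ∫ y in (-1)..1, g y := by
    intro g
    rw [mI, intervalIntegral.integral_of_le (by norm_num), integral_Icc_eq_integral_Ioc]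
  rw [e1, e1]
  have e2 : ∀ y, v (p + t * (y - p)) = v (t * y + (p - t * p)) := by
    intro y; congr 1; ring
  simp_rw [e2]
  rw [intervalIntegral.integral_comp_mul_add _ ht0.ne', smul_eq_mul]
  obtain ⟨hp1, hp2⟩ := hp
  gcongr
  refine intervalIntegral.integral_mono_interval ?_ ?_ ?_ ?_ (hv.intervalIntegrable _ _)
  · nlinarith
  · nlinarith
  · nlinarith
  · filter_upwards with x using h0 x

lemma scale2 {v : ℝ × ℝ → ℝ} (hv : Continuous v) (h0 : ∀ x, 0 ≤ v x) {p : ℝ × ℝ} {t : ℝ}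
    (hp : p ∈ Icc (-1 : ℝ) 1 ×ˢ Icc (-1 : ℝ) 1) (ht0 : 0 < t) (ht1 : t ≤ 1) :
    ∫ y, v (p + t • (y - p)) ∂mQ ≤ t⁻¹ ^ 2 * ∫ y, v y ∂mQ := by
  have i1 : Integrable (fun y => v (p + t • (y - p))) mQ := int_mQ (by fun_prop)
  have i2 : Integrable v mQ := int_mQ hv
  obtain ⟨p1, p2⟩ := p
  obtain ⟨hp1, hp2⟩ := hp
  have cA : Continuous (fun a => ∫ b, v (a, b) ∂mI) :=
    continuous_parametric_integral_of_continuous (f := fun a b => v (a, b)) (by fun_prop)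
      isCompact_Icc
  calc ∫ y, v ((p1, p2) + t • (y - (p1, p2))) ∂mQ
      = ∫ a, ∫ b, v (p1 + t * (a - p1), p2 + t * (b - p2)) ∂mI ∂mI := by
        rw [mQ] at i1 ⊢
        rw [integral_prod _ i1]
        rfl
    _ ≤ ∫ a, t⁻¹ * ∫ b, v (p1 + t * (a - p1), b) ∂mI ∂mI := by
        refine integral_mono ?_ ?_ ?_
        · rw [mQ] at i1
          exact i1.integral_prod_left
        · exact int_mI (continuous_const.mul (cA.comp (by fun_prop : Continuous fun a => p1 + t * (a - p1))))
        · intro a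
          exact scale1 (v := fun b => v (p1 + t * (a - p1), b)) (by fun_prop) (fun _ => h0 _) hp2 ht0 ht1
    _ ≤ t⁻¹ * (t⁻¹ * ∫ a, ∫ b, v (a, b) ∂mI ∂mI) := by
        rw [integral_const_mul]
        gcongr
        exact scale1 cA (fun a => integral_nonneg fun b => h0 _) hp1 ht0 ht1
    _ = _ := by
        rw [mQ] at i2 ⊢
        rw [integral_prod _ i2]; ring

lemma young4 {V c : ℝ} (hc : 0 < c) : V ≤ 3 / 4 * c + V ^ 4 / (4 * c ^ 3) := by
  have : 3 / 4 * c + V ^ 4 / (4 * c ^ 3) - V = (V - c) ^ 2 * ((V + c) ^ 2 + 2 * c ^ 2) / (4 * c ^ 3) := by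
    field_simp; ring
  have : 0 ≤ (V - c) ^ 2 * ((V + c) ^ 2 + 2 * c ^ 2) / (4 * c ^ 3) := by positivity
  linarith

lemma morrey {k V : ℝ × ℝ → ℝ} (hk : ContDiff ℝ 1 k) (hV : Continuous V) (V0 : ∀ q, 0 ≤ V q)
    (hb : ∀ q ∈ Icc (-1 : ℝ) 1 ×ˢ Icc (-1 : ℝ) 1, |k q| ≤ V q ∧ ‖fderiv ℝ k q‖ ≤ V q)
    {μ : ℝ} (hμ : 0 < μ) (hM : ∫ q, V q ^ 4 ∂mQ ≤ μ ^ 4) {p : ℝ × ℝ}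
    (hp : p ∈ Icc (-1 : ℝ) 1 ×ˢ Icc (-1 : ℝ) 1) : |k p| ≤ 5 * μ := by
  have hconv : Convex ℝ (Icc (-1 : ℝ) 1 ×ˢ Icc (-1 : ℝ) 1) := (convex_Icc _ _).prod (convex_Icc _ _)
  have S1 : ∀ y ∈ Icc (-1 : ℝ) 1 ×ˢ Icc (-1 : ℝ) 1,
      |k p| ≤ V y + 2 * ∫ t in Ioc (0 : ℝ) 1, V (p + t • (y - p)) := by
    intro y hy
    have d : ∀ t : ℝ, HasDerivAt (fun t : ℝ => k (p + t • (y - p)))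
        (fderiv ℝ k (p + t • (y - p)) (y - p)) t := by
      intro t
      have h1 : HasDerivAt (fun t : ℝ => p + t • (y - p)) (y - p) t := by
        simpa using ((hasDerivAt_id t).smul_const (y - p)).const_add p
      exact ((hk.differentiable one_ne_zero) _).hasFDerivAt.comp_hasDerivAt t h1
    have cd : Continuous (fun t : ℝ => fderiv ℝ k (p + t • (y - p)) (y - p)) := by
      have := hk.continuous_fderiv one_ne_zero
      fun_prop
    have e := intervalIntegral.integral_eq_sub_of_hasDerivAt (a := 0) (b := 1)
      (fun z _ => d z) (cd.intervalIntegrable _ _)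
    simp only [one_smul, zero_smul, add_zero, add_sub_cancel] at e
    have ny : ‖y - p‖ ≤ 2 := by
      obtain ⟨⟨_, _⟩, _, _⟩ := hy
      obtain ⟨⟨_, _⟩, _, _⟩ := hp
      rw [Prod.norm_def]
      refine max_le ?_ ?_ <;> simp only [Prod.fst_sub, Prod.snd_sub, Real.norm_eq_abs, abs_le] <;>
        constructor <;> linarith
    have h2 : |k y - k p| ≤ 2 * ∫ t in Ioc (0 : ℝ) 1, V (p + t • (y - p)) := by
      rw [← e, intervalIntegral.integral_of_le zero_le_one, ← integral_const_mul, ← Real.norm_eq_abs]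
      refine norm_integral_le_of_norm_le ?_ ?_
      · exact (Continuous.integrableOn_Ioc (by fun_prop))
      · filter_upwards [ae_restrict_mem measurableSet_Ioc] with t ht
        have hm : p + t • (y - p) ∈ Icc (-1 : ℝ) 1 ×ˢ Icc (-1 : ℝ) 1 :=
          hconv.add_smul_sub_mem hp hy ⟨ht.1.le, ht.2⟩
        refine (ContinuousLinearMap.le_opNorm _ _).trans ?_
        have := (hb _ hm).2
        have := V0 (p + t • (y - p))
        rw [mul_comm]
        gcongr
    have h3 := (hb y hy).1
    have : |k p| ≤ |k y| + |k y - k p| := by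
      have := abs_sub_abs_le_abs_sub (k p) (k y)
      rw [abs_sub_comm (k p)] at this; linarith
    linarith
  have S2 : ∀ t ∈ Ioc (0 : ℝ) 1, ∫ y, V (p + t • (y - p)) ∂mQ ≤ 4 * μ * t ^ (-(1 / 2) : ℝ) := by
    intro t ht
    obtain ⟨c, hc⟩ : ∃ c, c = t ^ (-(1 / 2) : ℝ) := ⟨_, rfl⟩
    have hc0 : 0 < c := by rw [hc]; exact Real.rpow_pos_of_pos ht.1 _
    have hc2 : c ^ 2 = t⁻¹ := by
      rw [hc, ← Real.rpow_natCast, ← Real.rpow_mul ht.1.le, ← Real.rpow_neg_one]; norm_num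
    rw [← hc]
    calc ∫ y, V (p + t • (y - p)) ∂mQ
        ≤ ∫ y, (3 / 4 * (c * μ) + (4 * (c * μ) ^ 3)⁻¹ * V (p + t • (y - p)) ^ 4) ∂mQ := by
          refine integral_mono (int_mQ (by fun_prop)) (int_mQ (by fun_prop)) ?_
          intro y
          have := young4 (V := V (p + t • (y - p))) (mul_pos hc0 hμ)
          rw [div_eq_inv_mul (V (p + t • (y - p)) ^ 4)] at this
          exact this
      _ = 3 * (c * μ) + (4 * (c * μ) ^ 3)⁻¹ * ∫ y, V (p + t • (y - p)) ^ 4 ∂mQ := by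
          rw [integral_add (integrable_const _) (int_mQ (by fun_prop)),
            integral_const_mul ((4 * (c * μ) ^ 3)⁻¹), integral_const, mQ_univ, smul_eq_mul]
          congr 1; ring
      _ ≤ 3 * (c * μ) + (4 * (c * μ) ^ 3)⁻¹ * (t⁻¹ ^ 2 * μ ^ 4) := by
          gcongr
          refine (scale2 (v := fun q => V q ^ 4) (by fun_prop) (fun q => by positivity) hp ht.1 ht.2).trans ?_
          gcongr
      _ = (13 / 4) * (c * μ) := by
          rw [← hc2]; field_simp; ring
      _ ≤ _ := by nlinarith [mul_pos hc0 hμ]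
  have iF : Integrable (Function.uncurry fun (y : ℝ × ℝ) (t : ℝ) => V (p + t • (y - p)))
      (mQ.prod (volume.restrict (Ioc (0 : ℝ) 1))) := by
    rw [mQ_eq, Measure.prod_restrict]
    have : IntegrableOn (Function.uncurry fun (y : ℝ × ℝ) (t : ℝ) => V (p + t • (y - p)))
      ((Icc (-1) 1 ×ˢ Icc (-1) 1) ×ˢ Icc (0:ℝ) 1) (volume.prod volume) := by
      refine ContinuousOn.integrableOn_compact ((isCompact_Icc.prod isCompact_Icc).prod isCompact_Icc) ?_
      apply Continuous.continuousOn
      unfold Function.uncurry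
      fun_prop
    exact this.mono_set (prod_mono le_rfl Ioc_subset_Icc_self)
  have S3 : 4 * |k p| ≤ (∫ y, V y ∂mQ) + 2 * ∫ t in Ioc (0 : ℝ) 1, ∫ y, V (p + t • (y - p)) ∂mQ := by
    have iG : Integrable (fun y => 2 * ∫ t in Ioc (0 : ℝ) 1, V (p + t • (y - p))) mQ :=
      iF.integral_prod_left.const_mul 2
    rw [← integral_integral_swap iF, ← integral_const_mul, ← integral_add (int_mQ hV) iG]
    have : 4 * |k p| = ∫ y, |k p| ∂mQ := by
      rw [integral_const, mQ_univ, smul_eq_mul]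
    rw [this]
    refine integral_mono_ae (integrable_const _) ((int_mQ hV).add iG) ?_
    filter_upwards [ae_mQ] with y hy using S1 y hy
  have S4 : ∫ y, V y ∂mQ ≤ 4 * μ := by
    have := S2 1 ⟨one_pos, le_rfl⟩
    simpa using this
  have iR : IntegrableOn (fun t : ℝ => 4 * μ * t ^ (-(1 / 2) : ℝ)) (Ioc 0 1) := by
    have := (intervalIntegral.intervalIntegrable_rpow' (a := 0) (b := 1) (r := -(1/2)) (by norm_num)).const_mul (4 * μ)
    rwa [intervalIntegrable_iff_integrableOn_Ioc_of_le zero_le_one] at this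
  have S5 : ∫ t in Ioc (0 : ℝ) 1, ∫ y, V (p + t • (y - p)) ∂mQ ≤ 8 * μ := by
    refine (setIntegral_mono_on iF.integral_prod_right iR measurableSet_Ioc S2).trans ?_
    rw [← intervalIntegral.integral_of_le zero_le_one, intervalIntegral.integral_const_mul,
      integral_rpow (Or.inl (by norm_num))]
    norm_num
    linarith
  linarith

/-- length of `(1, a, b)`. -/
def nn (q : ℝ × ℝ) : ℝ := √(1 + q.1 ^ 2 + q.2 ^ 2)

/-- cubed-sphere chart. -/
def om (q : ℝ × ℝ) : E3 := (nn q)⁻¹ • !₂[1, q.1, q.2]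

/-- identification of `ℝ × ℝ × ℝ` with `E3`. -/
def Phi (p : ℝ × ℝ × ℝ) : E3 := !₂[p.1, p.2.1, p.2.2]

lemma nn_pos (q : ℝ × ℝ) : 0 < nn q := Real.sqrt_pos.2 (by positivity)

lemma nn_contDiff {n : WithTop ℕ∞} : ContDiff ℝ n nn := by
  unfold nn
  apply ContDiff.sqrt
  · fun_prop
  · intro q; positivity

lemma om_contDiff {n : WithTop ℕ∞} : ContDiff ℝ n om := by
  unfold om
  apply ContDiff.fun_smul
  · exact nn_contDiff.inv (fun q => (nn_pos q).ne')
  · apply contDiff_euclidean.2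
    intro i
    fin_cases i <;> simp <;> fun_prop

lemma norm_om (q : ℝ × ℝ) : ‖om q‖ = 1 := by
  unfold om
  rw [norm_smul, norm_inv, Real.norm_of_nonneg (nn_pos q).le, EuclideanSpace.norm_eq,
    Fin.sum_univ_three]
  simp only [Real.norm_eq_abs, sq_abs]
  have : √(1 ^ 2 + q.1 ^ 2 + q.2 ^ 2) = nn q := by simp [nn]
  simp only [Matrix.cons_val_zero, Matrix.cons_val_one, Matrix.cons_val]
  rw [this]
  exact inv_mul_cancel₀ (nn_pos q).ne'

lemma nn_le {q : ℝ × ℝ} (hq : q ∈ Icc (-1 : ℝ) 1 ×ˢ Icc (-1 : ℝ) 1) : nn q ≤ 2 := by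
  obtain ⟨⟨h1, h2⟩, ⟨h3, h4⟩⟩ := hq
  unfold nn
  rw [Real.sqrt_le_left (by norm_num)]
  nlinarith

lemma Phi_mp : MeasurePreserving Phi := by
  have h1 := PiLp.volume_preserving_toLp (Fin 3)
  have h2 := (volume_preserving_piFinSuccAbove (fun _ : Fin 3 => ℝ) 0).symm
  have h3 := (volume_preserving_finTwoArrow ℝ).symm
  have h4 := (MeasurePreserving.id (volume : Measure ℝ)).prod h3
  have h5 := h1.comp (h2.comp h4)
  convert h5 using 1
  swap
  · rw [Measure.volume_eq_prod, Measure.volume_eq_prod]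
  ext p i
  fin_cases i <;> simp [Phi, MeasurableEquiv.piFinSuccAbove, MeasurableEquiv.finTwoArrow]

lemma cvar (k : E3 → ENNReal) (hk : Measurable k) {ρ : ℝ} (hρ : 0 < ρ) :
    ∫⁻ p, k ((ρ * p.1) • om p.2) ∂(mJ.prod mQ)
      ≤ ENNReal.ofReal (8 * ρ⁻¹ ^ 3) * ∫⁻ x in {x : E3 | ρ ≤ ‖x‖ ∧ ‖x‖ ≤ 2 * ρ}, k x := by
  set A : Set E3 := {x : E3 | ρ ≤ ‖x‖ ∧ ‖x‖ ≤ 2 * ρ} with hA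
  have mA : MeasurableSet A :=
    (measurableSet_le measurable_const measurable_norm).inter
      (measurableSet_le measurable_norm measurable_const)
  set K : ℝ × ℝ × ℝ → ENNReal := fun p => A.indicator k (Phi p) with hK
  have mK : Measurable K := (hk.indicator mA).comp Phi_mp.measurable
  have e1 : ∫⁻ x in A, k x = ∫⁻ z, ∫⁻ q, K (z, q) := by
    rw [← lintegral_indicator mA, ← Phi_mp.lintegral_comp (hk.indicator mA)]
    rw [Measure.volume_eq_prod, lintegral_prod _ mK.aemeasurable]
  -- scaling in the two angular variables
  have e2 : ∀ z : ℝ, z ≠ 0 → ∫⁻ q : ℝ × ℝ, ENNReal.ofReal (z ^ 2) * K (z, z • q) = ∫⁻ q, K (z, q) := by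
    intro z hz
    have hm : Measurable fun q : ℝ × ℝ => K (z, q) := mK.comp (by fun_prop)
    have hm2 : Measurable fun q : ℝ × ℝ => z • q := by fun_prop
    have := Measure.map_addHaar_smul (volume : Measure (ℝ × ℝ)) hz
    have hm3 : Measurable fun q : ℝ × ℝ => K (z, z • q) := hm.comp hm2
    rw [lintegral_const_mul _ hm3]
    have h3 : ∫⁻ q : ℝ × ℝ, K (z, z • q) = ENNReal.ofReal |(z ^ 2)⁻¹| * ∫⁻ q, K (z, q) := by
      rw [← lintegral_map (f := fun q => K (z, q)) hm hm2, this]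
      simp
    rw [h3, ← mul_assoc, ← ENNReal.ofReal_mul (by positivity), abs_of_pos (by positivity),
      mul_inv_cancel₀ (by positivity)]
    simp
  have e3 : ∀ q ∈ Icc (-1 : ℝ) 1 ×ˢ Icc (-1 : ℝ) 1, ∫⁻ s, k ((ρ * s) • om q) ∂mJ
      ≤ ENNReal.ofReal (8 * ρ⁻¹ ^ 3) * ∫⁻ z, ENNReal.ofReal (z ^ 2) * K (z, z • q) := by
    intro q hq
    have hN := nn_pos q
    have hN2 := nn_le hq
    set c := ρ / nn q with hc
    have hcp : 0 < c := by positivity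
    set F : ℝ → ENNReal := fun z => ENNReal.ofReal (z ^ 2) * K (z, z • q) with hF
    have mF : Measurable F := by
      apply Measurable.mul
      · fun_prop
      · exact mK.comp (by fun_prop)
    have s1 : ∫⁻ s, k ((ρ * s) • om q) ∂mJ ≤ ∫⁻ s, ENNReal.ofReal (4 * ρ⁻¹ ^ 2) * F (c * s) ∂mJ := by
      apply lintegral_mono_ae
      filter_upwards [ae_mJ] with s hs
      have h1 : (ρ * s) • om q = Phi (c * s, (c * s) • q) := by
        ext i
        fin_cases i <;> simp [om, Phi, hc] <;> field_simp
      have h2 : (ρ * s) • om q ∈ A := by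
        simp only [hA, mem_ofPred_eq, norm_smul, norm_om, mul_one, Real.norm_eq_abs]
        rw [abs_of_pos (by nlinarith [hs.1])]
        constructor <;> nlinarith [hs.1, hs.2]
      have h3 : k ((ρ * s) • om q) = K (c * s, (c * s) • q) := by
        simp only [hK]
        rw [← h1, indicator_of_mem h2]
      rw [h3]
      simp only [hF]
      rw [← mul_assoc, ← ENNReal.ofReal_mul (by positivity)]
      have h4 : (1 : ℝ) ≤ 4 * ρ⁻¹ ^ 2 * (c * s) ^ 2 := by
        have : 4 * ρ⁻¹ ^ 2 * (c * s) ^ 2 = (2 * s / nn q) ^ 2 := by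
          rw [hc]; field_simp; ring
        rw [this]
        have : 1 ≤ 2 * s / nn q := by
          rw [le_div_iff₀ hN]; linarith [hs.1]
        nlinarith
      calc K (c * s, (c * s) • q) = 1 * K (c * s, (c * s) • q) := by simp
        _ ≤ _ := by
          gcongr
          rw [← ENNReal.ofReal_one]
          exact ENNReal.ofReal_le_ofReal h4
    have s2 : ∫⁻ s, ENNReal.ofReal (4 * ρ⁻¹ ^ 2) * F (c * s) ∂mJ
        ≤ ENNReal.ofReal (4 * ρ⁻¹ ^ 2) * ∫⁻ s, F (c * s) := by
      have hm3 : Measurable fun s : ℝ => F (c * s) := mF.comp (by fun_prop)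
      rw [lintegral_const_mul _ hm3]
      gcongr
      exact Measure.restrict_le_self
    have s3 : ∫⁻ s, F (c * s) = ENNReal.ofReal c⁻¹ * ∫⁻ z, F z := by
      rw [← lintegral_map (f := F) (g := fun s => c * s) mF (by fun_prop), Real.map_volume_mul_left hcp.ne']
      simp [abs_of_pos hcp]
    refine (s1.trans s2).trans ?_
    rw [s3, ← mul_assoc, ← ENNReal.ofReal_mul (by positivity)]
    refine mul_le_mul' (ENNReal.ofReal_le_ofReal ?_) le_rfl
    rw [hc]
    have : 4 * ρ⁻¹ ^ 2 * (ρ / nn q)⁻¹ = 4 * ρ⁻¹ ^ 3 * nn q := by field_simp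
    rw [this]
    have : 0 < ρ⁻¹ ^ 3 := by positivity
    nlinarith
  have cont : Continuous fun p : ℝ × ℝ × ℝ => (ρ * p.1) • om p.2 := by
    have := (om_contDiff (n := 0)).continuous
    fun_prop
  have mG : Measurable fun p : ℝ × ℝ × ℝ => ENNReal.ofReal (p.1 ^ 2) * K (p.1, p.1 • p.2) := by
    apply Measurable.mul
    · fun_prop
    · exact mK.comp (by fun_prop)
  calc ∫⁻ p, k ((ρ * p.1) • om p.2) ∂(mJ.prod mQ)
      = ∫⁻ q, ∫⁻ s, k ((ρ * s) • om q) ∂mJ ∂mQ :=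
        lintegral_prod_symm _ (hk.comp cont.measurable).aemeasurable
    _ ≤ ∫⁻ q, ENNReal.ofReal (8 * ρ⁻¹ ^ 3) * (∫⁻ z, ENNReal.ofReal (z ^ 2) * K (z, z • q)) ∂mQ := by
        apply lintegral_mono_ae
        filter_upwards [ae_mQ] with q hq using e3 q hq
    _ = ENNReal.ofReal (8 * ρ⁻¹ ^ 3) * ∫⁻ q, (∫⁻ z, ENNReal.ofReal (z ^ 2) * K (z, z • q)) ∂mQ := by
        rw [lintegral_const_mul]
        exact mG.lintegral_prod_left'
    _ ≤ ENNReal.ofReal (8 * ρ⁻¹ ^ 3) * ∫⁻ q, (∫⁻ z, ENNReal.ofReal (z ^ 2) * K (z, z • q)) := by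
        gcongr
        rw [mQ_eq]; exact Measure.restrict_le_self
    _ = ENNReal.ofReal (8 * ρ⁻¹ ^ 3) * ∫⁻ z, (∫⁻ q : ℝ × ℝ, ENNReal.ofReal (z ^ 2) * K (z, z • q)) := by
        rw [lintegral_lintegral_swap]
        exact (mG.comp measurable_swap).aemeasurable
    _ = ENNReal.ofReal (8 * ρ⁻¹ ^ 3) * ∫⁻ x in A, k x := by
        rw [e1]
        congr 1
        apply lintegral_congr_ae
        have : ∀ᵐ z : ℝ, z ≠ 0 := by simp [ae_iff]
        filter_upwards [this] with z hz using e2 z hz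

lemma cvar_real {k : E3 → ℝ} (hk : Continuous k) (k0 : ∀ x, 0 ≤ k x) {ρ : ℝ} (hρ : 0 < ρ) :
    ∫ p, k ((ρ * p.1) • om p.2) ∂(mJ.prod mQ)
      ≤ 8 * ρ⁻¹ ^ 3 * ∫ x in {x : E3 | ρ ≤ ‖x‖ ∧ ‖x‖ ≤ 2 * ρ}, k x := by
  have cont : Continuous fun p : ℝ × ℝ × ℝ => (ρ * p.1) • om p.2 := by
    have := (om_contDiff (n := 0)).continuous
    fun_prop
  have h := cvar (fun x => ENNReal.ofReal (k x)) (by fun_prop) hρ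
  set A : Set E3 := {x : E3 | ρ ≤ ‖x‖ ∧ ‖x‖ ≤ 2 * ρ} with hA
  have cA : IsCompact A := by
    apply (isCompact_closedBall (0 : E3) (2 * ρ)).of_isClosed_subset
    · exact (isClosed_le continuous_const continuous_norm).inter
        (isClosed_le continuous_norm continuous_const)
    · intro x hx; simpa using hx.2
  have iA : IntegrableOn k A := hk.continuousOn.integrableOn_compact cA
  rw [← ofReal_integral_eq_lintegral_ofReal iA (Filter.Eventually.of_forall k0)] at h
  rw [← ENNReal.ofReal_mul (by positivity),
    ← ofReal_integral_eq_lintegral_ofReal (f := fun p : ℝ × ℝ × ℝ => k ((ρ * p.1) • om p.2))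
      (int_mJQ (hk.comp cont)) (Filter.Eventually.of_forall fun p => k0 _)] at h
  refine (ENNReal.ofReal_le_ofReal_iff ?_).1 h
  have : 0 ≤ ∫ x in A, k x := integral_nonneg k0
  positivity

/-- the six isometries that move the chart around. -/
def sg (j : Fin 3 × Bool) : E3 ≃ₗᵢ[ℝ] E3 :=
  if j.2 then LinearIsometryEquiv.piLpCongrLeft 2 ℝ ℝ (Equiv.swap 0 j.1)
  else (LinearIsometryEquiv.piLpCongrLeft 2 ℝ ℝ (Equiv.swap 0 j.1)).trans (LinearIsometryEquiv.neg ℝ)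

/-- the parameter square. -/
abbrev Qs : Set (ℝ × ℝ) := Icc (-1 : ℝ) 1 ×ˢ Icc (-1 : ℝ) 1

lemma om_surj {x : E3} (hx : ‖x‖ = 1) (h0 : 0 < x 0) (h1 : |x 1| ≤ x 0) (h2 : |x 2| ≤ x 0) :
    ∃ q ∈ Qs, om q = x := by
  refine ⟨(x 1 / x 0, x 2 / x 0), ⟨?_, ?_⟩, ?_⟩
  · rw [abs_le] at h1
    constructor
    · rw [le_div_iff₀ h0]; linarith
    · rw [div_le_iff₀ h0]; linarith
  · rw [abs_le] at h2
    constructor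
    · rw [le_div_iff₀ h0]; linarith
    · rw [div_le_iff₀ h0]; linarith
  · have hn : x 0 ^ 2 + x 1 ^ 2 + x 2 ^ 2 = 1 := by
      rw [EuclideanSpace.norm_eq, Fin.sum_univ_three] at hx
      simp only [Real.norm_eq_abs, sq_abs] at hx
      have := congrArg (· ^ 2) hx
      rw [Real.sq_sqrt (by positivity)] at this
      simpa using this
    have hnn : nn (x 1 / x 0, x 2 / x 0) = (x 0)⁻¹ := by
      unfold nn
      rw [Real.sqrt_eq_iff_mul_self_eq (by positivity) (by positivity)]
      field_simp
      linarith
    ext i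
    unfold om
    rw [hnn, inv_inv]
    fin_cases i <;> simp <;> field_simp

lemma cover {x : E3} (hx : ‖x‖ = 1) : ∃ j, ∃ q ∈ Qs, sg j (om q) = x := by
  obtain ⟨i, hi⟩ := Finite.exists_max (fun i : Fin 3 => |x i|)
  have hpos : 0 < |x i| := by
    by_contra h
    have : x = 0 := by
      ext j
      have := hi j
      have := abs_nonneg (x j)
      simp only [PiLp.zero_apply]
      apply abs_eq_zero.1; linarith
    rw [this] at hx; simp at hx
  set τ := LinearIsometryEquiv.piLpCongrLeft 2 ℝ ℝ (Equiv.swap 0 i) with hτ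
  have key : ∀ (y : E3) (k : Fin 3), τ y k = y (Equiv.swap 0 i k) := by
    intro y k
    simp [hτ, LinearIsometryEquiv.piLpCongrLeft_apply]
  have inv : ∀ y : E3, τ (τ y) = y := by
    intro y; ext k; rw [key, key]; simp
  rcases le_total 0 (x i) with h | h
  · have hp : 0 < x i := by rwa [abs_of_nonneg h] at hpos
    obtain ⟨q, hq, e⟩ := om_surj (x := τ x) (by simp [hx]) (by rw [key]; simpa using hp)
      (by rw [key, key]; simpa [abs_of_pos hp] using hi (Equiv.swap 0 i 1))
      (by rw [key, key]; simpa [abs_of_pos hp] using hi (Equiv.swap 0 i 2))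
    refine ⟨(i, true), q, hq, ?_⟩
    simp only [sg, if_true]
    rw [← hτ, e, inv]
  · have hp : x i < 0 := by rw [abs_of_nonpos h] at hpos; linarith
    obtain ⟨q, hq, e⟩ := om_surj (x := τ (-x)) (by simp [hx]) (by rw [key]; simpa using hp)
      (by rw [key, key]; simpa [abs_of_neg hp] using hi (Equiv.swap 0 i 1))
      (by rw [key, key]; simpa [abs_of_neg hp] using hi (Equiv.swap 0 i 2))
    refine ⟨(i, false), q, hq, ?_⟩
    simp only [sg]
    rw [← hτ]
    simp [e, inv]

lemma Qs_compact : IsCompact Qs := isCompact_Icc.prod isCompact_Icc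
lemma Qs_convex : Convex ℝ Qs := (convex_Icc _ _).prod (convex_Icc _ _)
lemma Qs_meas : MeasurableSet Qs := measurableSet_Icc.prod measurableSet_Icc

lemma om_lip : ∃ K : NNReal, LipschitzOnWith K om Qs :=
  (om_contDiff (n := 1)).contDiffOn.exists_lipschitzOnWith (by norm_num) Qs_convex Qs_compact

lemma haus_le : ∃ K : NNReal, ∀ j, (μH[2] : Measure E3).restrict ((fun q => sg j (om q)) '' Qs)
    ≤ (K : ENNReal) • Measure.map (fun q => sg j (om q)) mQ := by
  obtain ⟨K, hK⟩ := om_lip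
  refine ⟨K ^ 2, fun j => ?_⟩
  have hKj : LipschitzOnWith K (fun q => sg j (om q)) Qs := by
    have := (sg j).isometry.lipschitz.comp_lipschitzOnWith hK
    rw [one_mul] at this
    exact this
  have cont : Continuous fun q => sg j (om q) :=
    (sg j).continuous.comp (om_contDiff (n := 0)).continuous
  rw [Measure.le_iff]
  intro s hs
  rw [Measure.restrict_apply hs, Measure.smul_apply, Measure.map_apply cont.measurable hs]
  have e : s ∩ (fun q => sg j (om q)) '' Qs = (fun q => sg j (om q)) '' ((fun q => sg j (om q)) ⁻¹' s ∩ Qs) := by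
    rw [image_preimage_inter]
  rw [e]
  have h1 := (hKj.mono (inter_subset_right (s := (fun q => sg j (om q)) ⁻¹' s))).hausdorffMeasure_image_le (d := 2) (by norm_num)
  refine h1.trans ?_
  rw [hausdorffMeasure_prod_real, mQ_eq, Measure.restrict_apply (cont.measurable hs)]
  simp

lemma sphI_le : ∃ C : ℝ, 0 ≤ C ∧ ∀ G : E3 → ℝ, Continuous G → (∀ x, 0 ≤ G x) →
    sphI G ≤ C * ∑ j, ∫ q, G (sg j (om q)) ∂mQ := by
  obtain ⟨K, hK⟩ := haus_le
  refine ⟨K, K.2, fun G hG G0 => ?_⟩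
  have cont : ∀ j, Continuous fun q => sg j (om q) := fun j =>
    (sg j).continuous.comp (om_contDiff (n := 0)).continuous
  have hsub : sphere1 ⊆ ⋃ j, (fun q => sg j (om q)) '' Qs := by
    intro x hx
    have : ‖x‖ = 1 := by simpa [sphere1] using hx
    obtain ⟨j, q, hq, e⟩ := cover this
    exact mem_iUnion.2 ⟨j, q, hq, e⟩
  have hle : (μH[2] : Measure E3).restrict sphere1 ≤
      ∑ j, (K : ENNReal) • Measure.map (fun q => sg j (om q)) mQ := by
    calc (μH[2] : Measure E3).restrict sphere1
        ≤ (μH[2] : Measure E3).restrict (⋃ j, (fun q => sg j (om q)) '' Qs) :=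
          Measure.restrict_mono hsub le_rfl
      _ ≤ Measure.sum fun j => (μH[2] : Measure E3).restrict ((fun q => sg j (om q)) '' Qs) :=
          Measure.restrict_iUnion_le
      _ = ∑ j, (μH[2] : Measure E3).restrict ((fun q => sg j (om q)) '' Qs) := by
          rw [Measure.sum_fintype]
      _ ≤ _ := Finset.sum_le_sum fun j _ => hK j
  have hGint : ∀ j, Integrable G ((K : ENNReal) • Measure.map (fun q => sg j (om q)) mQ) := by
    intro j
    apply Integrable.smul_measure _ (by simp)
    rw [integrable_map_measure hG.aestronglyMeasurable (cont j).aemeasurable]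
    exact int_mQ (hG.comp (cont j))
  have := integral_mono_measure (f := G) hle (Filter.Eventually.of_forall G0)
    (integrable_finsetSum_measure.2 fun j _ => hGint j)
  refine this.trans (le_of_eq ?_)
  rw [integral_finsetSum_measure (fun j _ => hGint j), Finset.mul_sum]
  refine Finset.sum_congr rfl fun j _ => ?_
  rw [integral_smul_measure, integral_map (cont j).aemeasurable hG.aestronglyMeasurable]
  simp

lemma dir_contDiff {f : Spt → ℝ} (hf : ContDiff ℝ (⊤ : ℕ∞) f) (v : Spt) :
    ContDiff ℝ (⊤ : ℕ∞) fun p => fderiv ℝ f p v := by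
  have h : ContDiff ℝ (⊤ : ℕ∞) (fderiv ℝ f) := hf.fderiv_right (by norm_cast)
  exact h.clm_apply contDiff_const

lemma dir_bound {f : Spt → ℝ} (hf : ContDiff ℝ (⊤ : ℕ∞) f) {v : Spt} (hv : ‖v‖ ≤ 1) (m : ℕ) (p : Spt) :
    ‖iteratedFDeriv ℝ m (fun p => fderiv ℝ f p v) p‖ ≤ ‖iteratedFDeriv ℝ (m + 1) f p‖ := by
  have h : ContDiff ℝ (⊤ : ℕ∞) (fderiv ℝ f) := hf.fderiv_right (by norm_cast)
  have h1 := norm_iteratedFDeriv_clm_apply_const (f := fderiv ℝ f) (c := v) (x := p) (n := m)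
    (h.contDiffAt) (by exact_mod_cast le_top)
  rw [norm_iteratedFDeriv_fderiv] at h1
  refine h1.trans ?_
  nlinarith [norm_nonneg (iteratedFDeriv ℝ (m + 1) f p)]

/-- spatial coordinate as a linear map. -/
def cL (i : Fin 3) : Spt →L[ℝ] ℝ := (EuclideanSpace.proj i).comp (ContinuousLinearMap.snd ℝ ℝ E3)

lemma cL_apply (i : Fin 3) (p : Spt) : cL i p = p.2 i := rfl

lemma cL_le (i : Fin 3) (p : Spt) : |cL i p| ≤ ‖p.2‖ := by
  have := PiLp.norm_apply_le p.2 i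
  simpa [cL_apply] using this

lemma cL_norm (i : Fin 3) : ‖cL i‖ ≤ 1 := by
  apply ContinuousLinearMap.opNorm_le_bound _ zero_le_one
  intro p
  rw [one_mul]
  exact (cL_le i p).trans (norm_snd_le p)

lemma cL_mul_bound (i : Fin 3) {g : Spt → ℝ} (hg : ContDiff ℝ (⊤ : ℕ∞) g) (m : ℕ) (p : Spt) :
    ‖iteratedFDeriv ℝ m (fun p => p.2 i * g p) p‖ ≤
      ‖p.2‖ * ‖iteratedFDeriv ℝ m g p‖ + m * ‖iteratedFDeriv ℝ (m - 1) g p‖ := by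
  have hc : ContDiff ℝ (⊤ : ℕ∞) (cL i) := (cL i).contDiff
  have h := norm_iteratedFDeriv_mul_le (f := fun p => cL i p) (g := g) hc hg p (n := m)
    (by exact_mod_cast le_top)
  simp only [cL_apply] at h
  refine h.trans ?_
  have fd : fderiv ℝ (fun p : Spt => p.2 i) = fun _ => cL i := by
    funext x
    exact (cL i).fderiv
  have h2 : ∀ j, ‖iteratedFDeriv ℝ (j + 2) (fun p : Spt => p.2 i) p‖ = 0 := by
    intro j
    rw [← norm_iteratedFDeriv_fderiv, fd, iteratedFDeriv_const_of_ne (by omega)]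
    simp
  have h1 : ‖iteratedFDeriv ℝ 1 (fun p : Spt => p.2 i) p‖ ≤ 1 := by
    rw [← norm_iteratedFDeriv_fderiv (n := 0), fd]
    simpa using cL_norm i
  have h0 : ‖iteratedFDeriv ℝ 0 (fun p : Spt => p.2 i) p‖ ≤ ‖p.2‖ := by
    simpa [cL_apply] using cL_le i p
  rcases m with _ | m
  · simp only [zero_add, Finset.sum_range_one, Nat.choose_self, Nat.cast_one, one_mul, Nat.sub_zero,
      Nat.cast_zero, zero_mul, add_zero]
    gcongr
  · rw [Finset.sum_range_succ', Finset.sum_range_succ']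
    have : ∑ k ∈ Finset.range m, ((m + 1).choose (k + 1 + 1) : ℝ) *
        ‖iteratedFDeriv ℝ (k + 1 + 1) (fun p : Spt => p.2 i) p‖ * ‖iteratedFDeriv ℝ (m + 1 - (k + 1 + 1)) g p‖ = 0 := by
      apply Finset.sum_eq_zero
      intro k _
      rw [h2 k]; simp
    rw [this]
    simp only [zero_add, Nat.choose_one_right, Nat.choose_zero_right, Nat.cast_one, one_mul, Nat.sub_zero]
    have e1 := norm_nonneg (iteratedFDeriv ℝ (m + 1) g p)
    have e2 := norm_nonneg (iteratedFDeriv ℝ (m + 1 - 1) g p)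
    have e3 : (0 : ℝ) ≤ ((m + 1 : ℕ) : ℝ) := by positivity
    nlinarith [mul_le_mul_of_nonneg_right h0 e1, mul_le_mul_of_nonneg_left (mul_le_mul_of_nonneg_right h1 e2) e3]

lemma coord_norm (μ : Fin 4) : ‖coordVec μ‖ ≤ 1 := by
  unfold coordVec
  split_ifs
  · simp [Prod.norm_def]
  · simp [Prod.norm_def]

lemma dxv_norm (j : Fin 3) : ‖((0 : ℝ), (EuclideanSpace.single j (1 : ℝ) : E3))‖ ≤ 1 := by
  simp [Prod.norm_def]

lemma app_contDiff (Z : VF) {f : Spt → ℝ} (hf : ContDiff ℝ (⊤ : ℕ∞) f) :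
    ContDiff ℝ (⊤ : ℕ∞) (Z.app f) := by
  cases Z with
  | pd μ => exact dir_contDiff hf _
  | rot i j =>
    have h1 := dir_contDiff hf ((0 : ℝ), (EuclideanSpace.single j (1 : ℝ) : E3))
    have h2 := dir_contDiff hf ((0 : ℝ), (EuclideanSpace.single i (1 : ℝ) : E3))
    have e1 := ((cL i).contDiff (n := (⊤ : ℕ∞))).mul h1
    have e2 := ((cL j).contDiff (n := (⊤ : ℕ∞))).mul h2
    exact e1.sub e2

lemma Zop_contDiff (Zl : List VF) {f : Spt → ℝ} (hf : ContDiff ℝ (⊤ : ℕ∞) f) :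
    ContDiff ℝ (⊤ : ℕ∞) (Zop Zl f) := by
  induction Zl with
  | nil => exact hf
  | cons Z l ih => exact app_contDiff Z ih

lemma rot_bound (i j : Fin 3) {f : Spt → ℝ} (hf : ContDiff ℝ (⊤ : ℕ∞) f) (m : ℕ) (p : Spt) :
    ‖iteratedFDeriv ℝ m (rot i j f) p‖ ≤
      2 * (‖p.2‖ * ‖iteratedFDeriv ℝ (m + 1) f p‖ + m * ‖iteratedFDeriv ℝ m f p‖) := by
  have key : ∀ i j : Fin 3, ‖iteratedFDeriv ℝ m (fun p : Spt => p.2 i * dx j f p) p‖ ≤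
      ‖p.2‖ * ‖iteratedFDeriv ℝ (m + 1) f p‖ + m * ‖iteratedFDeriv ℝ m f p‖ := by
    intro i j
    have hd : ContDiff ℝ (⊤ : ℕ∞) (dx j f) := dir_contDiff hf _
    refine (cL_mul_bound i hd m p).trans ?_
    apply add_le_add
    · exact mul_le_mul_of_nonneg_left (dir_bound hf (dxv_norm j) m p) (norm_nonneg _)
    · rcases m with _ | m
      · simp
      · exact mul_le_mul_of_nonneg_left (dir_bound hf (dxv_norm j) m p) (by positivity)
  have cd : ∀ i j : Fin 3, ContDiff ℝ (⊤ : ℕ∞) (fun p : Spt => p.2 i * dx j f p) := fun i j =>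
    ((cL i).contDiff (n := (⊤ : ℕ∞))).mul (dir_contDiff hf _)
  have : rot i j f = (fun p : Spt => p.2 i * dx j f p) - (fun p : Spt => p.2 j * dx i f p) := rfl
  rw [this, iteratedFDeriv_sub_apply ((cd i j).contDiffAt.of_le (by exact_mod_cast le_top))
    ((cd j i).contDiffAt.of_le (by exact_mod_cast le_top))]
  refine (norm_sub_le _ _).trans ?_
  linarith [key i j, key j i]

/-- weighted sum of derivatives. -/
def Bs (k : ℕ) (e : ℤ) (φ : Spt → ℝ) (p : Spt) : ℝ :=
  ∑ l ∈ Finset.Icc (min 1 k) k, ‖p.2‖ ^ ((l : ℤ) + e) * ‖iteratedFDeriv ℝ l φ p‖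

lemma Bs_nonneg (k : ℕ) (e : ℤ) (φ : Spt → ℝ) (p : Spt) : 0 ≤ Bs k e φ p :=
  Finset.sum_nonneg fun _ _ => by positivity

lemma Bs_mul (k : ℕ) (e : ℤ) (φ : Spt → ℝ) (p : Spt) (hp : 0 < ‖p.2‖) :
    ‖p.2‖ * Bs k (e - 1) φ p = Bs k e φ p := by
  unfold Bs
  rw [Finset.mul_sum]
  refine Finset.sum_congr rfl fun l _ => ?_
  rw [← mul_assoc]
  congr 1
  have : (l : ℤ) + e = (l + (e - 1)) + 1 := by ring
  rw [this, zpow_add_one₀ hp.ne', mul_comm]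

lemma Bs_mono (k : ℕ) (hk : 1 ≤ k) (e : ℤ) (φ : Spt → ℝ) (p : Spt) :
    Bs k e φ p ≤ Bs (k + 1) e φ p := by
  unfold Bs
  apply Finset.sum_le_sum_of_subset_of_nonneg
  · intro l hl
    simp only [Finset.mem_Icc] at hl ⊢
    omega
  · intro l _ _; positivity

lemma Zbound (i : ℕ) : ∀ m : ℕ, ∃ C : ℝ, 0 ≤ C ∧ ∀ Zl : List VF, Zl.length = i → ∀ φ : Spt → ℝ,
    ContDiff ℝ (⊤ : ℕ∞) φ → ∀ p : Spt, 0 < ‖p.2‖ →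
    ‖iteratedFDeriv ℝ m (Zop Zl φ) p‖ ≤ C * Bs (i + m) (zeta Zl - m) φ p := by
  induction i with
  | zero =>
    intro m
    refine ⟨1, zero_le_one, fun Zl hZ φ hφ p hp => ?_⟩
    rw [List.length_eq_zero_iff] at hZ
    subst hZ
    rw [one_mul]
    have := Finset.single_le_sum (s := Finset.Icc (min 1 (0 + m)) (0 + m)) (a := m)
      (f := fun l : ℕ => ‖p.2‖ ^ ((l : ℤ) + (zeta [] - m)) * ‖iteratedFDeriv ℝ l φ p‖)
      (fun _ _ => by positivity) (by simp)
    refine le_trans ?_ this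
    simp [zeta, Zop]
  | succ i ih =>
    intro m
    obtain ⟨C1, C10, h1⟩ := ih (m + 1)
    obtain ⟨C2, C20, h2⟩ := ih m
    refine ⟨2 * (C1 + m * C2), by positivity, fun Zl hZ φ hφ p hp => ?_⟩
    cases Zl with
    | nil => simp at hZ
    | cons Z l =>
      have hl : l.length = i := by simpa using hZ
      have b1 := h1 l hl φ hφ p hp
      have b2 := h2 l hl φ hφ p hp
      have ek : i + 1 + m = i + (m + 1) := by ring
      have hsm := Zop_contDiff l hφ
      cases Z with
      | pd μ =>
        have ez : zeta (VF.pd μ :: l) - m = zeta l - ((m + 1 : ℕ) : ℤ) := by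
          simp [zeta, VF.zeta]; ring
        rw [ez, ek]
        have : ‖iteratedFDeriv ℝ m (Zop (VF.pd μ :: l) φ) p‖ ≤ ‖iteratedFDeriv ℝ (m + 1) (Zop l φ) p‖ :=
          dir_bound hsm (coord_norm μ) m p
        refine (this.trans b1).trans ?_
        apply mul_le_mul_of_nonneg_right _ (Bs_nonneg _ _ _ _)
        have : 0 ≤ m * C2 := by positivity
        linarith
      | rot a b =>
        have ez : zeta (VF.rot a b :: l) - m = zeta l - (m : ℤ) := by
          simp [zeta, VF.zeta]
        rw [ez, ek]
        have h3 : ‖iteratedFDeriv ℝ m (Zop (VF.rot a b :: l) φ) p‖ ≤ _ := rot_bound a b hsm m p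
        refine h3.trans ?_
        have e1 : ‖p.2‖ * Bs (i + (m + 1)) (zeta l - ((m + 1 : ℕ) : ℤ)) φ p = Bs (i + (m + 1)) (zeta l - (m : ℤ)) φ p := by
          rw [← Bs_mul _ (zeta l - (m : ℤ)) φ p hp]
          congr 2
          push_cast; ring
        have e2 : m * ‖iteratedFDeriv ℝ m (Zop l φ) p‖ ≤ m * (C2 * Bs (i + (m + 1)) (zeta l - (m : ℤ)) φ p) := by
          rcases Nat.eq_zero_or_pos m with h | h
          · subst h; simp
          · refine mul_le_mul_of_nonneg_left (b2.trans ?_) (by positivity)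
            exact mul_le_mul_of_nonneg_left (Bs_mono (i + m) (by omega) _ φ p) C20
        have e3 := mul_le_mul_of_nonneg_left b1 hp.le
        have e4 : ‖p.2‖ * (C1 * Bs (i + (m + 1)) (zeta l - ((m + 1 : ℕ) : ℤ)) φ p) = C1 * Bs (i + (m + 1)) (zeta l - (m : ℤ)) φ p := by
          rw [← e1]; ring
        rw [e4] at e3
        linarith

/-- the integrand of the data norm. -/
def eD (k : ℕ) (γ q₀ : ℝ) (φ : Spt → ℝ) (x : E3) : ℝ :=
  (1 + ‖x‖) ^ (γ - 2) * (φ (0, x)) ^ 2 + ∑ l ∈ Finset.range (k + 1),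
    (1 + ‖x‖) ^ (γ + 2 * (l : ℝ)) * ((idfNST (l + 1) φ (0, x)) ^ 2 + q₀ * (idfNST l φ (0, x)) ^ 2)

lemma eD_nonneg (k : ℕ) (γ : ℝ) {q₀ : ℝ} (hq : 0 ≤ q₀) (φ : Spt → ℝ) (x : E3) : 0 ≤ eD k γ q₀ φ x := by
  unfold eD
  have : ∀ l ∈ Finset.range (k + 1), 0 ≤ (1 + ‖x‖) ^ (γ + 2 * (l : ℝ)) *
      ((idfNST (l + 1) φ (0, x)) ^ 2 + q₀ * (idfNST l φ (0, x)) ^ 2) := fun l _ => by positivity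
  have := Finset.sum_nonneg this
  positivity

lemma eD_mono {k k' : ℕ} (h : k ≤ k') (γ : ℝ) {q₀ : ℝ} (hq : 0 ≤ q₀) (φ : Spt → ℝ) (x : E3) :
    eD k γ q₀ φ x ≤ eD k' γ q₀ φ x := by
  unfold eD
  gcongr

lemma eD_int {n k : ℕ} {γ R q₀ : ℝ} {φ : Spt → ℝ} (h : DataFiniteST n γ R q₀ φ) (hk : k ≤ n) :
    IntegrableOn (eD k γ q₀ φ) {x : E3 | R ≤ ‖x‖} ∧
    ∫ x in {x : E3 | R ≤ ‖x‖}, eD k γ q₀ φ x = dataNormST k γ R q₀ φ := by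
  have hs : ∀ l ∈ Finset.range (k + 1), IntegrableOn
    (fun x : E3 => (1 + ‖x‖) ^ (γ + 2 * (l : ℝ)) *
      ((idfNST (l + 1) φ (0, x)) ^ 2 + q₀ * (idfNST l φ (0, x)) ^ 2))
    {x : E3 | R ≤ ‖x‖} := fun l hl => h.2 l (by have := Finset.mem_range.1 hl; omega)
  have hi := integrable_finsetSum (Finset.range (k + 1)) hs
  constructor
  · exact h.1.add hi
  · unfold eD dataNormST
    rw [integral_add h.1 hi, integral_finsetSum _ hs]

lemma rset_meas (R : ℝ) : MeasurableSet {x : E3 | R ≤ ‖x‖} :=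
  measurableSet_le measurable_const measurable_norm

lemma dataNormST_nonneg {n k : ℕ} {γ R q₀ : ℝ} {φ : Spt → ℝ} (hq : 0 ≤ q₀) (h : DataFiniteST n γ R q₀ φ)
    (hk : k ≤ n) : 0 ≤ dataNormST k γ R q₀ φ := by
  rw [← (eD_int h hk).2]
  exact integral_nonneg fun x => eD_nonneg k γ hq φ x

lemma dataNormST_mono {n k k' : ℕ} {γ R q₀ : ℝ} {φ : Spt → ℝ} (hq : 0 ≤ q₀) (h : DataFiniteST n γ R q₀ φ)
    (hk : k' ≤ n) (hkk : k ≤ k') : dataNormST k γ R q₀ φ ≤ dataNormST k' γ R q₀ φ := by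
  rw [← (eD_int h hk).2, ← (eD_int h (hkk.trans hk)).2]
  exact integral_mono (eD_int h (hkk.trans hk)).1 (eD_int h hk).1 fun x => eD_mono hkk γ hq φ x

lemma zeta_nonpos (Zl : List VF) : zeta Zl ≤ 0 := by
  induction Zl with
  | nil => simp [zeta]
  | cons Z l ih =>
    have : zeta (Z :: l) = Z.zeta + zeta l := by simp [zeta]
    rw [this]
    have : Z.zeta ≤ 0 := by cases Z <;> simp [VF.zeta]
    omega

lemma zeta_ge (Zl : List VF) : -(Zl.length : ℤ) ≤ zeta Zl := by
  induction Zl with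
  | nil => simp [zeta]
  | cons Z l ih =>
    have : zeta (Z :: l) = Z.zeta + zeta l := by simp [zeta]
    rw [this]
    have : -1 ≤ Z.zeta := by cases Z <;> simp [VF.zeta]
    push_cast [List.length_cons]
    omega

lemma term_le (k : ℕ) {γ q₀ : ℝ} (g1 : 1 < γ) (g2 : γ < 2) (hq : 0 ≤ q₀) (φ : Spt → ℝ) (x : E3) (hx : 2 ≤ ‖x‖)
    (l : ℕ) (hl : l ∈ Finset.Icc (min 1 k) k) :
    ‖x‖ ^ (γ - 2 + 2 * (l : ℝ)) * ‖iteratedFDeriv ℝ l φ (0, x)‖ ^ 2 ≤ 2 * eD (k - 1) γ q₀ φ x := by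
  have hr : 0 < ‖x‖ := by linarith
  rw [Finset.mem_Icc] at hl
  have hnn : ∀ l ∈ Finset.range (k - 1 + 1), 0 ≤ (1 + ‖x‖) ^ (γ + 2 * (l : ℝ)) *
      ((idfNST (l + 1) φ (0, x)) ^ 2 + q₀ * (idfNST l φ (0, x)) ^ 2) := fun l _ => by positivity
  rcases l with _ | l
  · have h1 : ‖x‖ ^ (γ - 2) ≤ 2 * (1 + ‖x‖) ^ (γ - 2) := by
      have a1 : ‖x‖ ^ (γ - 2) ≤ ((1 + ‖x‖) / 2) ^ (γ - 2) :=
        Real.rpow_le_rpow_of_nonpos (by positivity) (by linarith) (by linarith)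
      have a2 : ((1 + ‖x‖) / 2) ^ (γ - 2) = (2 : ℝ) ^ (2 - γ) * (1 + ‖x‖) ^ (γ - 2) := by
        rw [Real.div_rpow (by positivity) (by norm_num), div_eq_mul_inv, ← Real.rpow_neg (by norm_num), mul_comm]
        congr 2; ring
      have a3 : (2 : ℝ) ^ (2 - γ) ≤ 2 := by
        calc (2 : ℝ) ^ (2 - γ) ≤ 2 ^ (1 : ℝ) := Real.rpow_le_rpow_of_exponent_le (by norm_num) (by linarith)
          _ = 2 := by simp
      rw [a2] at a1
      refine a1.trans ?_
      gcongr
    have hs := Finset.sum_nonneg hnn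
    unfold eD
    simp only [Nat.cast_zero, mul_zero, add_zero, norm_iteratedFDeriv_zero, Real.norm_eq_abs, sq_abs]
    nlinarith [mul_le_mul_of_nonneg_right h1 (sq_nonneg (φ (0, x)))]
  · have h1 := Finset.single_le_sum hnn (a := l) (by rw [Finset.mem_range]; omega)
    have h2 : 0 ≤ (1 + ‖x‖) ^ (γ - 2) * (φ (0, x)) ^ 2 := by positivity
    have h3 : ‖x‖ ^ (γ - 2 + 2 * ((l + 1 : ℕ) : ℝ)) ≤ (1 + ‖x‖) ^ (γ + 2 * (l : ℝ)) := by
      have : γ - 2 + 2 * ((l + 1 : ℕ) : ℝ) = γ + 2 * (l : ℝ) := by push_cast; ring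
      rw [this]
      exact Real.rpow_le_rpow hr.le (by linarith) (by positivity)
    have h4 : ‖x‖ ^ (γ - 2 + 2 * ((l + 1 : ℕ) : ℝ)) * ‖iteratedFDeriv ℝ (l + 1) φ (0, x)‖ ^ 2 ≤
       (1 + ‖x‖) ^ (γ + 2 * (l : ℝ)) *
      ((idfNST (l + 1) φ (0, x)) ^ 2 + q₀ * (idfNST l φ (0, x)) ^ 2) := by
      apply mul_le_mul h3 _ (by positivity) (by positivity)
      unfold idfNST
      have : 0 ≤ q₀ * ‖iteratedFDeriv ℝ l φ (0, x)‖ ^ 2 := by positivity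
      linarith
    have h5 := eD_nonneg (k - 1) γ hq φ x
    have h6 : ‖x‖ ^ (γ - 2 + 2 * ((l + 1 : ℕ) : ℝ)) * ‖iteratedFDeriv ℝ (l + 1) φ (0, x)‖ ^ 2 ≤ eD (k - 1) γ q₀ φ x := by
      unfold eD
      linarith
    linarith

lemma Bs_sq (k : ℕ) (e : ℤ) {γ q₀ : ℝ} (g1 : 1 < γ) (g2 : γ < 2) (hq : 0 ≤ q₀) (φ : Spt → ℝ) (x : E3) (hx : 2 ≤ ‖x‖) :
    ‖x‖ ^ (γ - 2 - 2 * (e : ℝ)) * Bs k e φ (0, x) ^ 2 ≤ (k + 1) ^ 2 * (2 * eD (k - 1) γ q₀ φ x) := by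
  have hr : 0 < ‖x‖ := by linarith
  have hE := eD_nonneg (k - 1) γ hq φ x
  have hcard : ((Finset.Icc (min 1 k) k).card : ℝ) ≤ k + 1 := by
    rw [Nat.card_Icc]
    norm_cast
    omega
  have h1 : Bs k e φ (0, x) ^ 2 ≤ (k + 1) * ∑ l ∈ Finset.Icc (min 1 k) k, (‖x‖ ^ ((l : ℤ) + e) * ‖iteratedFDeriv ℝ l φ (0, x)‖) ^ 2 := by
    unfold Bs
    refine sq_sum_le_card_mul_sum_sq.trans ?_
    exact mul_le_mul_of_nonneg_right hcard (Finset.sum_nonneg fun _ _ => sq_nonneg _)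
  calc ‖x‖ ^ (γ - 2 - 2 * (e : ℝ)) * Bs k e φ (0, x) ^ 2
      ≤ ‖x‖ ^ (γ - 2 - 2 * (e : ℝ)) * ((k + 1) * ∑ l ∈ Finset.Icc (min 1 k) k, (‖x‖ ^ ((l : ℤ) + e) * ‖iteratedFDeriv ℝ l φ (0, x)‖) ^ 2) := by
        gcongr
    _ = (k + 1) * ∑ l ∈ Finset.Icc (min 1 k) k, ‖x‖ ^ (γ - 2 + 2 * (l : ℝ)) * ‖iteratedFDeriv ℝ l φ (0, x)‖ ^ 2 := by
        rw [mul_left_comm, Finset.mul_sum]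
        congr 1
        refine Finset.sum_congr rfl fun l _ => ?_
        rw [mul_pow, ← mul_assoc]
        congr 1
        rw [← Real.rpow_intCast, ← Real.rpow_natCast, ← Real.rpow_mul hr.le, ← Real.rpow_add hr]
        congr 1
        push_cast; ring
    _ ≤ (k + 1) * ∑ l ∈ Finset.Icc (min 1 k) k, (2 * eD (k - 1) γ q₀ φ x) := by
        refine mul_le_mul_of_nonneg_left (Finset.sum_le_sum fun l hl => ?_) (by positivity)
        exact term_le k g1 g2 hq φ x hx l hl
    _ ≤ _ := by
        rw [Finset.sum_const, nsmul_eq_mul, pow_two, mul_assoc]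
        gcongr

lemma Zpoint : ∃ C : ℝ, 0 ≤ C ∧ ∀ (Zl : List VF) (m : ℕ), Zl.length ≤ 4 → m ≤ 1 → ∀ (γ q₀ : ℝ) (φ : Spt → ℝ),
    1 < γ → γ < 2 → 0 ≤ q₀ → ContDiff ℝ (⊤ : ℕ∞) φ → ∀ x : E3, 2 ≤ ‖x‖ →
    ‖x‖ ^ (γ - 2 - 2 * (zeta Zl : ℝ) + 2 * (m : ℝ)) * ‖iteratedFDeriv ℝ m (Zop Zl φ) (0, x)‖ ^ 2
      ≤ C * eD (Zl.length + m - 1) γ q₀ φ x := by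
  choose Cf Cf0 hCf using Zbound
  set C := ∑ i ∈ Finset.range 5, ∑ m ∈ Finset.range 2, Cf i m with hC
  have C0 : 0 ≤ C := Finset.sum_nonneg fun i _ => Finset.sum_nonneg fun m _ => Cf0 i m
  refine ⟨C ^ 2 * 72, by positivity, ?_⟩
  intro Zl m hZ hm γ q₀ φ g1 g2 hq hφ x hx
  have hr : 0 < ‖x‖ := by linarith
  have hCle : Cf Zl.length m ≤ C := by
    have a1 := Finset.single_le_sum (s := Finset.range 2) (f := fun m => Cf Zl.length m) (a := m)
      (fun m _ => Cf0 _ m) (by rw [Finset.mem_range]; omega)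
    have a2 := Finset.single_le_sum (s := Finset.range 5) (f := fun i => ∑ m ∈ Finset.range 2, Cf i m) (a := Zl.length)
      (fun i _ => Finset.sum_nonneg fun m _ => Cf0 i m) (by rw [Finset.mem_range]; omega)
    exact a1.trans a2
  have h := hCf Zl.length m Zl rfl φ hφ (0, x) hr
  have hB := Bs_nonneg (Zl.length + m) (zeta Zl - m) φ (0, x)
  have h' : ‖iteratedFDeriv ℝ m (Zop Zl φ) (0, x)‖ ^ 2 ≤ (C * Bs (Zl.length + m) (zeta Zl - m) φ (0, x)) ^ 2 := by
    gcongr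
    exact h.trans (mul_le_mul_of_nonneg_right hCle hB)
  have e : γ - 2 - 2 * (zeta Zl : ℝ) + 2 * (m : ℝ) = γ - 2 - 2 * ((zeta Zl - m : ℤ) : ℝ) := by push_cast; ring
  have hb := Bs_sq (Zl.length + m) (zeta Zl - m) g1 g2 hq φ x hx
  have hE := eD_nonneg (Zl.length + m - 1) γ hq φ x
  rw [e]
  calc _ ≤ ‖x‖ ^ (γ - 2 - 2 * ((zeta Zl - m : ℤ) : ℝ)) * (C * Bs (Zl.length + m) (zeta Zl - m) φ (0, x)) ^ 2 := by
        gcongr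
    _ = C ^ 2 * (‖x‖ ^ (γ - 2 - 2 * ((zeta Zl - m : ℤ) : ℝ)) * Bs (Zl.length + m) (zeta Zl - m) φ (0, x) ^ 2) := by ring
    _ ≤ C ^ 2 * ((((Zl.length + m : ℕ) : ℝ) + 1) ^ 2 * (2 * eD (Zl.length + m - 1) γ q₀ φ x)) := by gcongr
    _ ≤ C ^ 2 * ((6 : ℝ) ^ 2 * (2 * eD (Zl.length + m - 1) γ q₀ φ x)) := by
        have : ((Zl.length + m : ℕ) : ℝ) ≤ 5 := by exact_mod_cast (by omega : Zl.length + m ≤ 5)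
        gcongr
        linarith
    _ = _ := by ring

/-- parametrised chart of the annulus. -/
def psi (p : ℝ × ℝ × ℝ) : E3 := p.1 • om p.2

lemma psi_contDiff {n : WithTop ℕ∞} : ContDiff ℝ n psi := by
  unfold psi
  apply ContDiff.fun_smul
  · exact contDiff_fst
  · exact om_contDiff.comp contDiff_snd

lemma psi_bound : ∃ L : ℝ, 0 ≤ L ∧ ∀ p ∈ Icc (1 : ℝ) 2 ×ˢ Qs, ‖fderiv ℝ psi p‖ ≤ L := by
  have hc : Continuous fun p => fderiv ℝ psi p := (psi_contDiff (n := 1)).continuous_fderiv (by norm_num)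
  obtain ⟨L, hL⟩ := (isCompact_Icc.prod Qs_compact).exists_bound_of_continuousOn hc.continuousOn
    (s := Icc (1 : ℝ) 2 ×ˢ Qs)
  exact ⟨max L 0, le_max_right _ _, fun p hp => (hL p hp).trans (le_max_left _ _)⟩

lemma rpow_cmp {ρ r β : ℝ} (hρ : 0 < ρ) (h1 : ρ ≤ r) (h2 : r ≤ 2 * ρ) (hβ : -1 ≤ β) :
    ρ ^ β ≤ 2 * r ^ β := by
  have hr : 0 < r := by linarith
  rcases le_total 0 β with h | h
  · have := Real.rpow_le_rpow hρ.le h1 h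
    have : 0 ≤ r ^ β := by positivity
    linarith
  · have a1 : ρ ^ β ≤ (r / 2) ^ β := Real.rpow_le_rpow_of_nonpos (by positivity) (by linarith) h
    have a2 : (r / 2) ^ β = 2 ^ (-β) * r ^ β := by
      rw [Real.div_rpow hr.le (by norm_num), div_eq_mul_inv, ← Real.rpow_neg (by norm_num), mul_comm]
    have a3 : (2 : ℝ) ^ (-β) ≤ 2 := by
      calc (2 : ℝ) ^ (-β) ≤ 2 ^ (1 : ℝ) := Real.rpow_le_rpow_of_exponent_le (by norm_num) (by linarith)
        _ = 2 := by simp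
    rw [a2] at a1
    refine a1.trans ?_
    gcongr

/-- the annulus. -/
def ann (ρ : ℝ) : Set E3 := {x : E3 | ρ ≤ ‖x‖ ∧ ‖x‖ ≤ 2 * ρ}

lemma ann_compact (ρ : ℝ) : IsCompact (ann ρ) := by
  apply (isCompact_closedBall (0 : E3) (2 * ρ)).of_isClosed_subset
  · exact (isClosed_le continuous_const continuous_norm).inter
      (isClosed_le continuous_norm continuous_const)
  · intro x hx; simpa using hx.2

lemma ann_rot (σ : E3 ≃ₗᵢ[ℝ] E3) (k : E3 → ℝ) (ρ : ℝ) :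
    ∫ x in ann ρ, k (σ x) = ∫ x in ann ρ, k x := by
  have h := σ.measurePreserving.setIntegral_preimage_emb σ.toMeasurableEquiv.measurableEmbedding k (ann ρ)
  rw [← h]
  congr 2
  ext x
  simp [ann]

/-- general trace estimate in one chart -/
lemma trace4 : ∃ L : ℝ, 0 ≤ L ∧ ∀ (g : E3 → ℝ), ContDiff ℝ 1 g → ∀ (j : Fin 3 × Bool) (ρ : ℝ), 0 < ρ →
    ∫ q, g (ρ • sg j (om q)) ^ 4 ∂mQ ≤
      (304 * (ρ⁻¹ ^ 3 * ∫ x in ann ρ, (g x ^ 2 + L * (ρ ^ 2 * ‖fderiv ℝ g x‖ ^ 2)))) ^ 2 := by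
  obtain ⟨L, L0, hL⟩ := psi_bound
  refine ⟨L ^ 2, by positivity, fun g hg j ρ hρ => ?_⟩
  set h : ℝ × ℝ × ℝ → ℝ := fun p => g (ρ • sg j (psi p)) with hh
  set ch : ℝ × ℝ × ℝ → E3 := fun p => ρ • sg j (psi p) with hch
  have cdch : ContDiff ℝ 1 ch := ((sg j).contDiff.comp psi_contDiff).const_smul ρ
  have cdh : ContDiff ℝ 1 h := hg.comp cdch
  have hd : Differentiable ℝ h := cdh.differentiable (by norm_num)
  have cfd : Continuous (fderiv ℝ h) := cdh.continuous_fderiv (by norm_num)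
  set w : ℝ × ℝ × ℝ → ℝ := fun p => |g (ch p)| + ρ * L * ‖fderiv ℝ g (ch p)‖ with hw
  have cg : Continuous (fderiv ℝ g) := hg.continuous_fderiv (by norm_num)
  have cw : Continuous w := by
    have := cdch.continuous
    have := hg.continuous
    fun_prop
  have fdb : ∀ p ∈ Icc (1 : ℝ) 2 ×ˢ Qs, ‖fderiv ℝ h p‖ ≤ w p := by
    intro p hp
    have e1 : fderiv ℝ h p = (fderiv ℝ g (ch p)).comp (fderiv ℝ ch p) :=
      fderiv_comp p (hg.differentiable (by norm_num) _) (cdch.differentiable (by norm_num) _)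
    have e2 : HasFDerivAt ch (ρ • ((sg j).toContinuousLinearEquiv.toContinuousLinearMap.comp (fderiv ℝ psi p))) p := by
      have d := (psi_contDiff (n := 1)).differentiable (by norm_num) p
      exact (((sg j).toContinuousLinearEquiv.hasFDerivAt).comp p d.hasFDerivAt).const_smul ρ
    have e3 : ‖fderiv ℝ ch p‖ ≤ ρ * L := by
      rw [e2.fderiv, norm_smul, Real.norm_of_nonneg hρ.le]
      refine mul_le_mul_of_nonneg_left ?_ hρ.le
      apply ContinuousLinearMap.opNorm_le_bound _ L0
      intro v
      have : ‖(sg j) ((fderiv ℝ psi p) v)‖ ≤ L * ‖v‖ := by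
        rw [LinearIsometryEquiv.norm_map]
        exact ((fderiv ℝ psi p).le_opNorm v).trans (mul_le_mul_of_nonneg_right (hL p hp) (norm_nonneg _))
      exact this
    rw [e1]
    refine (ContinuousLinearMap.opNorm_comp_le _ _).trans ?_
    have : ‖fderiv ℝ g (ch p)‖ * ‖fderiv ℝ ch p‖ ≤ ‖fderiv ℝ g (ch p)‖ * (ρ * L) := by gcongr
    have := abs_nonneg (g (ch p))
    simp only [hw]
    linarith
  have fdv : ∀ p ∈ Icc (1 : ℝ) 2 ×ˢ Qs, ∀ v : ℝ × ℝ × ℝ, ‖v‖ ≤ 1 → |fderiv ℝ h p v| ≤ w p := by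
    intro p hp v hv
    refine le_trans ?_ (fdb p hp)
    refine ((fderiv ℝ h p).le_opNorm v).trans ?_
    nlinarith [norm_nonneg (fderiv ℝ h p)]
  have main := box_est (h := h) (h0 := fun p => fderiv ℝ h p (1, 0, 0)) (h1 := fun p => fderiv ℝ h p (0, 1, 0))
    (h2 := fun p => fderiv ℝ h p (0, 0, 1)) (w := w)
    (fun s q => (hd (s, q)).hasFDerivAt.comp_hasDerivAt (f := fun x => (x, q)) s
      ((hasDerivAt_id s).prodMk (hasDerivAt_const s q)))
    (fun s a b => (hd (s, a, b)).hasFDerivAt.comp_hasDerivAt (f := fun x => (s, x, b)) a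
      ((hasDerivAt_const a s).prodMk ((hasDerivAt_id a).prodMk (hasDerivAt_const a b))))
    (fun s a b => (hd (s, a, b)).hasFDerivAt.comp_hasDerivAt (f := fun x => (s, a, x)) b
      ((hasDerivAt_const b s).prodMk ((hasDerivAt_const b a).prodMk (hasDerivAt_id b))))
    cdh.continuous (by fun_prop) (by fun_prop) (by fun_prop) cw
    (by
      intro p hp
      refine ⟨?_, fdv p hp _ (by simp [Prod.norm_def]), fdv p hp _ (by simp [Prod.norm_def]),
        fdv p hp _ (by simp [Prod.norm_def])⟩
      simp only [hw, hh, hch]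
      have : 0 ≤ ρ * L * ‖fderiv ℝ g (ρ • (sg j) (psi p))‖ := by positivity
      linarith)
    (s₀ := 1) (by norm_num)
  have e0 : ∫ q, g (ρ • sg j (om q)) ^ 4 ∂mQ = ∫ q, h (1, q) ^ 4 ∂mQ := by
    simp [hh, psi]
  rw [e0]
  refine main.trans ?_
  set k : E3 → ℝ := fun x => g x ^ 2 + L ^ 2 * (ρ ^ 2 * ‖fderiv ℝ g x‖ ^ 2) with hk
  have ck : Continuous k := by
    have := hg.continuous
    fun_prop
  have k0 : ∀ x, 0 ≤ k x := fun x => by simp only [hk]; positivity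
  have cv := cvar_real (k := fun x => k (sg j x)) (ck.comp (sg j).continuous) (fun x => k0 _) hρ
  have e1 : ∫ p, w p ^ 2 ∂(mJ.prod mQ) ≤ ∫ p, 2 * k (sg j ((ρ * p.1) • om p.2)) ∂(mJ.prod mQ) := by
    apply integral_mono (int_mJQ (by fun_prop))
    · apply int_mJQ
      have := (om_contDiff (n := 0)).continuous
      have := (sg j).continuous
      fun_prop
    · intro p
      have : sg j ((ρ * p.1) • om p.2) = ch p := by
        simp only [hch, psi, mul_smul, map_smul]
      simp only [this, hw, hk]
      have s1 := sq_abs (g (ch p))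
      nlinarith [sq_nonneg (|g (ch p)| - ρ * L * ‖fderiv ℝ g (ch p)‖)]
  rw [integral_const_mul] at e1
  have e2 : 0 ≤ ∫ p, w p ^ 2 ∂(mJ.prod mQ) := integral_nonneg fun p => sq_nonneg _
  have e3 : ∫ x in {x : E3 | ρ ≤ ‖x‖ ∧ ‖x‖ ≤ 2 * ρ}, k (sg j x) = ∫ x in ann ρ, k x := ann_rot (sg j) k ρ
  rw [e3] at cv
  have : 19 * ∫ p, w p ^ 2 ∂(mJ.prod mQ) ≤ 304 * (ρ⁻¹ ^ 3 * ∫ x in ann ρ, k x) := by linarith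
  gcongr

lemma slice_contDiff {F : Spt → ℝ} (hF : ContDiff ℝ (⊤ : ℕ∞) F) : ContDiff ℝ 1 fun x : E3 => F (0, x) :=
  (hF.of_le (by exact_mod_cast le_top)).comp (contDiff_const.prodMk contDiff_id)

lemma slice_fderiv {F : Spt → ℝ} (hF : ContDiff ℝ (⊤ : ℕ∞) F) (x v : E3) :
    fderiv ℝ (fun x : E3 => F (0, x)) x v = fderiv ℝ F (0, x) (0, v) := by
  have h1 : HasFDerivAt (fun x : E3 => ((0 : ℝ), x)) (ContinuousLinearMap.inr ℝ ℝ E3) x :=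
    (ContinuousLinearMap.inr ℝ ℝ E3).hasFDerivAt
  have h2 := ((hF.differentiable (by simp)) (0, x)).hasFDerivAt
  have h3 : HasFDerivAt (fun x : E3 => F (0, x)) ((fderiv ℝ F (0, x)).comp (ContinuousLinearMap.inr ℝ ℝ E3)) x :=
    h2.comp x h1
  rw [h3.fderiv]
  rfl

lemma slice_norm {F : Spt → ℝ} (hF : ContDiff ℝ (⊤ : ℕ∞) F) (x : E3) :
    ‖fderiv ℝ (fun x : E3 => F (0, x)) x‖ ≤ ‖iteratedFDeriv ℝ 1 F (0, x)‖ := by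
  rw [norm_iteratedFDeriv_one]
  apply ContinuousLinearMap.opNorm_le_bound _ (norm_nonneg _)
  intro v
  rw [slice_fderiv hF]
  refine ((fderiv ℝ F (0, x)).le_opNorm _).trans ?_
  simp [Prod.norm_def]

/-- weighted L4 bound in each chart -/
lemma chart4 : ∃ C : ℝ, 0 ≤ C ∧ ∀ (Zl : List VF) (n : ℕ), Zl.length ≤ n → n ≤ 3 → ∀ (γ R q₀ : ℝ) (φ : Spt → ℝ),
    1 < γ → γ < 2 → 2 ≤ R → 0 ≤ q₀ → ContDiff ℝ (⊤ : ℕ∞) φ → DataFiniteST n γ R q₀ φ →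
    ∀ ρ, R ≤ ρ → ∀ j, ρ ^ (2 + 2 * γ - 4 * (zeta Zl : ℝ)) * ∫ q, (Zop Zl φ (0, ρ • sg j (om q))) ^ 4 ∂mQ
      ≤ (C * dataNormST Zl.length γ R q₀ φ) ^ 2 := by
  obtain ⟨L, L0, hL⟩ := trace4
  obtain ⟨C, C0, hC⟩ := Zpoint
  refine ⟨304 * (2 * C * (1 + L)), by positivity, ?_⟩
  intro Zl n hZ hn γ R q₀ φ g1 g2 hR hq hφ hD ρ hρ j
  have hρ0 : 0 < ρ := by linarith
  have hF := Zop_contDiff Zl hφ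
  have h := hL (fun x => Zop Zl φ (0, x)) (slice_contDiff hF) j ρ hρ0
  set g : E3 → ℝ := fun x => Zop Zl φ (0, x) with hg
  have cdg := slice_contDiff hF
  have cg : Continuous (fderiv ℝ g) := cdg.continuous_fderiv (by norm_num)
  have cg0 : Continuous g := cdg.continuous
  set β := γ - 2 - 2 * (zeta Zl : ℝ) with hβ
  have hz : (zeta Zl : ℝ) ≤ 0 := by exact_mod_cast zeta_nonpos Zl
  have hβ1 : -1 ≤ β := by linarith
  have subs : ann ρ ⊆ {x : E3 | R ≤ ‖x‖} := fun x hx => le_trans hρ hx.1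
  obtain ⟨iD, eDe⟩ := eD_int hD hZ
  have key : ρ ^ β * ∫ x in ann ρ, (g x ^ 2 + L * (ρ ^ 2 * ‖fderiv ℝ g x‖ ^ 2)) ≤
      2 * C * (1 + L) * dataNormST Zl.length γ R q₀ φ := by
    rw [← integral_const_mul, ← eDe]
    calc ∫ x in ann ρ, ρ ^ β * (g x ^ 2 + L * (ρ ^ 2 * ‖fderiv ℝ g x‖ ^ 2))
        ≤ ∫ x in ann ρ, 2 * C * (1 + L) * eD Zl.length γ q₀ φ x := by
          apply setIntegral_mono_on
          · exact Continuous.continuousOn (by fun_prop) |>.integrableOn_compact (ann_compact ρ)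
          · exact (iD.mono_set subs).const_mul _
          · exact (ann_compact ρ).measurableSet
          · intro x hx
            have hxr : 0 < ‖x‖ := lt_of_lt_of_le hρ0 hx.1
            have hx2 : 2 ≤ ‖x‖ := by linarith [hx.1]
            have a0 := hC Zl 0 (by omega) (by norm_num) γ q₀ φ g1 g2 hq hφ x hx2
            have a1 := hC Zl 1 (by omega) (by norm_num) γ q₀ φ g1 g2 hq hφ x hx2
            simp only [norm_iteratedFDeriv_zero, Real.norm_eq_abs, sq_abs, Nat.cast_zero, mul_zero, add_zero,
              ← hβ] at a0
            rw [← hβ] at a1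
            have m0 := eD_mono (show Zl.length - 1 ≤ Zl.length by omega) γ hq φ x
            have m1 : eD (Zl.length + 1 - 1) γ q₀ φ x = eD Zl.length γ q₀ φ x := by simp
            rw [m1] at a1
            have b := rpow_cmp hρ0 hx.1 hx.2 hβ1
            have sn := slice_norm hF x
            have b1 : ρ ^ β * g x ^ 2 ≤ 2 * (C * eD Zl.length γ q₀ φ x) := by
              have t1 : ρ ^ β * g x ^ 2 ≤ 2 * ‖x‖ ^ β * g x ^ 2 := by gcongr
              have t2 : ‖x‖ ^ β * g x ^ 2 ≤ C * eD Zl.length γ q₀ φ x :=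
                a0.trans (mul_le_mul_of_nonneg_left m0 C0)
              linarith
            have b2 : ρ ^ β * (ρ ^ 2 * ‖fderiv ℝ g x‖ ^ 2) ≤ 2 * (C * eD Zl.length γ q₀ φ x) := by
              have t1 : ρ ^ β * (ρ ^ 2 * ‖fderiv ℝ g x‖ ^ 2) ≤
                  2 * ‖x‖ ^ β * (‖x‖ ^ 2 * ‖iteratedFDeriv ℝ 1 (Zop Zl φ) (0, x)‖ ^ 2) := by
                have := hx.1
                gcongr
              have t2 : ‖x‖ ^ (β + 2 * ((1 : ℕ) : ℝ)) = ‖x‖ ^ β * ‖x‖ ^ 2 := by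
                rw [Real.rpow_add hxr]; norm_num
              rw [t2] at a1
              linarith
            have := mul_le_mul_of_nonneg_left b2 L0
            linarith
      _ ≤ ∫ x in {x : E3 | R ≤ ‖x‖}, 2 * C * (1 + L) * eD Zl.length γ q₀ φ x := by
          apply setIntegral_mono_set (iD.const_mul _)
          · refine Filter.Eventually.of_forall fun x => ?_
            have := eD_nonneg Zl.length γ hq φ x
            show 0 ≤ _
            positivity
          · exact subs.eventuallyLE
      _ = _ := by rw [integral_const_mul]
  have hI : 0 ≤ ∫ x in ann ρ, (g x ^ 2 + L * (ρ ^ 2 * ‖fderiv ℝ g x‖ ^ 2)) :=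
    integral_nonneg fun x => by positivity
  calc ρ ^ (2 + 2 * γ - 4 * (zeta Zl : ℝ)) * ∫ q, g (ρ • sg j (om q)) ^ 4 ∂mQ
      ≤ ρ ^ (2 + 2 * γ - 4 * (zeta Zl : ℝ)) *
        (304 * (ρ⁻¹ ^ 3 * ∫ x in ann ρ, (g x ^ 2 + L * (ρ ^ 2 * ‖fderiv ℝ g x‖ ^ 2)))) ^ 2 := by gcongr
    _ = (304 * (ρ ^ β * ∫ x in ann ρ, (g x ^ 2 + L * (ρ ^ 2 * ‖fderiv ℝ g x‖ ^ 2)))) ^ 2 := by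
        have : ρ ^ (2 + 2 * γ - 4 * (zeta Zl : ℝ)) = (ρ ^ β * ρ ^ 3) ^ 2 := by
          rw [← Real.rpow_natCast ρ 3, ← Real.rpow_add hρ0, ← Real.rpow_natCast, ← Real.rpow_mul hρ0.le]
          congr 1
          rw [hβ]; push_cast; ring
        rw [this]
        field_simp
    _ ≤ (304 * (2 * C * (1 + L) * dataNormST Zl.length γ R q₀ φ)) ^ 2 := by gcongr
    _ = _ := by ring

lemma sgom_cont (j : Fin 3 × Bool) : Continuous fun q => sg j (om q) :=
  (sg j).continuous.comp (om_contDiff (n := 0)).continuous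

lemma Zslice_cont (Zl : List VF) {φ : Spt → ℝ} (hφ : ContDiff ℝ (⊤ : ℕ∞) φ) :
    Continuous fun x : E3 => Zop Zl φ (0, x) :=
  (slice_contDiff (Zop_contDiff Zl hφ)).continuous

lemma part_two : ∃ C : ℝ, 0 ≤ C ∧ ∀ (Zl : List VF) (n : ℕ), Zl.length ≤ n → n ≤ 3 → ∀ (γ R q₀ : ℝ) (φ : Spt → ℝ),
    1 < γ → γ < 2 → 2 ≤ R → 0 ≤ q₀ → ContDiff ℝ (⊤ : ℕ∞) φ → DataFiniteST n γ R q₀ φ →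
    ∀ ρ, R ≤ ρ →
    sphI (fun ω => ρ ^ (2 + 2 * γ - 4 * (zeta Zl : ℝ)) * (Zop Zl φ (0, ρ • ω)) ^ 4)
      ≤ C * (dataNormST Zl.length γ R q₀ φ) ^ 2 := by
  obtain ⟨K, K0, hK⟩ := sphI_le
  obtain ⟨C, C0, hC⟩ := chart4
  refine ⟨K * 6 * C ^ 2, by positivity, ?_⟩
  intro Zl n hZ hn γ R q₀ φ g1 g2 hR hq hφ hD ρ hρ
  have hρ0 : 0 < ρ := by linarith
  have cz : Continuous fun ω : E3 => Zop Zl φ (0, ρ • ω) := (Zslice_cont Zl hφ).comp (continuous_const_smul ρ)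
  have h := hK (fun ω => ρ ^ (2 + 2 * γ - 4 * (zeta Zl : ℝ)) * (Zop Zl φ (0, ρ • ω)) ^ 4)
    (continuous_const.mul (cz.pow 4)) (fun x => by positivity)
  refine h.trans ?_
  have : ∑ j, ∫ q, ρ ^ (2 + 2 * γ - 4 * (zeta Zl : ℝ)) * (Zop Zl φ (0, ρ • sg j (om q))) ^ 4 ∂mQ ≤
      ∑ j : Fin 3 × Bool, (C * dataNormST Zl.length γ R q₀ φ) ^ 2 := by
    refine Finset.sum_le_sum fun j _ => ?_
    rw [integral_const_mul]
    exact hC Zl n hZ hn γ R q₀ φ g1 g2 hR hq hφ hD ρ hρ j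
  refine (mul_le_mul_of_nonneg_left this K0).trans (le_of_eq ?_)
  simp
  ring

lemma part_one : ∃ C : ℝ, 0 ≤ C ∧ ∀ (Zl : List VF) (n : ℕ), Zl.length ≤ n → n ≤ 3 → ∀ (γ R q₀ : ℝ) (φ : Spt → ℝ),
    1 < γ → γ < 2 → 2 ≤ R → 0 ≤ q₀ → ContDiff ℝ (⊤ : ℕ∞) φ → DataFiniteST n γ R q₀ φ →
    ∀ ρ, R ≤ ρ →
    sphI (fun ω => ρ ^ (1 + γ - 2 * (zeta Zl : ℝ)) * (Zop Zl φ (0, ρ • ω)) ^ 2)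
      ≤ C * dataNormST Zl.length γ R q₀ φ := by
  obtain ⟨K, K0, hK⟩ := sphI_le
  obtain ⟨C, C0, hC⟩ := chart4
  refine ⟨K * 6 * (2 * C), by positivity, ?_⟩
  intro Zl n hZ hn γ R q₀ φ g1 g2 hR hq hφ hD ρ hρ
  have hρ0 : 0 < ρ := by linarith
  have cz : Continuous fun ω : E3 => Zop Zl φ (0, ρ • ω) := (Zslice_cont Zl hφ).comp (continuous_const_smul ρ)
  have hE := dataNormST_nonneg hq hD hZ
  have h := hK (fun ω => ρ ^ (1 + γ - 2 * (zeta Zl : ℝ)) * (Zop Zl φ (0, ρ • ω)) ^ 2)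
    (continuous_const.mul (cz.pow 2)) (fun x => by positivity)
  refine h.trans ?_
  have : ∑ j, ∫ q, ρ ^ (1 + γ - 2 * (zeta Zl : ℝ)) * (Zop Zl φ (0, ρ • sg j (om q))) ^ 2 ∂mQ ≤
      ∑ j : Fin 3 × Bool, (2 * C * dataNormST Zl.length γ R q₀ φ) := by
    refine Finset.sum_le_sum fun j _ => ?_
    have hc := hC Zl n hZ hn γ R q₀ φ g1 g2 hR hq hφ hD ρ hρ j
    have cs0 := sgom_cont j
    set f : ℝ × ℝ → ℝ := fun q => ρ ^ (1 + γ - 2 * (zeta Zl : ℝ)) * (Zop Zl φ (0, ρ • sg j (om q))) ^ 2 with hf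
    have cf : Continuous f := continuous_const.mul ((cz.comp cs0).pow 2)
    have c1 := cs (μ := mQ) (f := f) (g := fun _ => 1) (int_mQ (by fun_prop)) (int_mQ (by fun_prop)) (int_mQ (by fun_prop))
    have e1 : ∫ q, f q ^ 2 ∂mQ = ρ ^ (2 + 2 * γ - 4 * (zeta Zl : ℝ)) * ∫ q, (Zop Zl φ (0, ρ • sg j (om q))) ^ 4 ∂mQ := by
      rw [← integral_const_mul]
      congr 1
      funext q
      have : ρ ^ (2 + 2 * γ - 4 * (zeta Zl : ℝ)) = (ρ ^ (1 + γ - 2 * (zeta Zl : ℝ))) ^ 2 := by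
        rw [← Real.rpow_natCast, ← Real.rpow_mul hρ0.le]
        congr 1
        push_cast; ring
      rw [this, hf]; ring
    have e2 : ∫ _q : ℝ × ℝ, (1 : ℝ) ^ 2 ∂mQ = 4 := by
      simp [mQ_univ]
    simp only [mul_one] at c1
    rw [e1, e2] at c1
    refine abs_le_of_sq_le_sq' ?_ (by positivity) |>.2
    nlinarith
  refine (mul_le_mul_of_nonneg_left this K0).trans (le_of_eq ?_)
  simp
  ring

lemma om_bound : ∃ L : ℝ, 0 ≤ L ∧ ∀ q ∈ Qs, ‖fderiv ℝ om q‖ ≤ L := by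
  have hc : Continuous fun p => fderiv ℝ om p := (om_contDiff (n := 1)).continuous_fderiv (by norm_num)
  obtain ⟨L, hL⟩ := Qs_compact.exists_bound_of_continuousOn hc.continuousOn
  exact ⟨max L 0, le_max_right _ _, fun p hp => (hL p hp).trans (le_max_left _ _)⟩

lemma coord_succ (i : Fin 3) : coordVec i.succ = (0, EuclideanSpace.single i 1) := by
  unfold coordVec
  fin_cases i <;> rfl

lemma slice_coord {F : Spt → ℝ} (hF : ContDiff ℝ (⊤ : ℕ∞) F) (x : E3) :
    ‖fderiv ℝ (fun x : E3 => F (0, x)) x‖ ≤ ∑ i : Fin 3, |pderiv i.succ F (0, x)| := by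
  apply ContinuousLinearMap.opNorm_le_bound _ (Finset.sum_nonneg fun _ _ => abs_nonneg _)
  intro v
  have hv : v = ∑ i, v i • (EuclideanSpace.single i (1 : ℝ) : E3) := by
    ext k
    fin_cases k <;> simp [Fin.sum_univ_three]
  have e : fderiv ℝ (fun x : E3 => F (0, x)) x v = ∑ i : Fin 3, v i * pderiv i.succ F (0, x) := by
    conv_lhs => rw [hv]
    rw [map_sum]
    refine Finset.sum_congr rfl fun i _ => ?_
    rw [map_smul, slice_fderiv hF, smul_eq_mul, pderiv, coord_succ]
  rw [e, Finset.sum_mul]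
  refine (norm_sum_le _ _).trans (Finset.sum_le_sum fun i _ => ?_)
  rw [norm_mul, mul_comm, Real.norm_eq_abs]
  exact mul_le_mul_of_nonneg_left (PiLp.norm_apply_le v i) (abs_nonneg _)

lemma four_pow (a b c d : ℝ) : (|a| + (|b| + |c| + |d|)) ^ 4 ≤ 64 * (a ^ 4 + (b ^ 4 + c ^ 4 + d ^ 4)) := by
  have ha := abs_nonneg a
  have hb := abs_nonneg b
  have hc := abs_nonneg c
  have hd := abs_nonneg d
  have e : ∀ x : ℝ, |x| ^ 4 = x ^ 4 := fun x => by
    rw [show (4 : ℕ) = 2 * 2 by norm_num, pow_mul, sq_abs, pow_mul]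
  have h1 := add_pow_le (add_nonneg ha hb) (add_nonneg hc hd) 4
  have h2 := add_pow_le ha hb 4
  have h3 := add_pow_le hc hd 4
  norm_num [e] at h1 h2 h3
  have : |a| + (|b| + |c| + |d|) = |a| + |b| + (|c| + |d|) := by ring
  rw [this]
  linarith

lemma part_four : ∃ C : ℝ, 0 ≤ C ∧ ∀ (Zl : List VF) (n : ℕ), Zl.length + 1 ≤ n → n ≤ 3 → ∀ (γ R q₀ : ℝ) (φ : Spt → ℝ),
    1 < γ → γ < 2 → 2 ≤ R → 0 ≤ q₀ → ContDiff ℝ (⊤ : ℕ∞) φ → DataFiniteST n γ R q₀ φ →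
    ∀ x : E3, R ≤ ‖x‖ →
    ‖x‖ ^ (1 + γ - 2 * (zeta Zl : ℝ)) * (Zop Zl φ (0, x)) ^ 2 ≤ C * dataNormST (Zl.length + 1) γ R q₀ φ := by
  obtain ⟨L, L0, hL⟩ := om_bound
  obtain ⟨C, C0, hC⟩ := chart4
  refine ⟨25 * (8 * (1 + 2 * L ^ 2) * C), by positivity, ?_⟩
  intro Zl n hZ hn γ R q₀ φ g1 g2 hR hq hφ hD x hx
  set ρ := ‖x‖ with hρ
  have hρ0 : 0 < ρ := by linarith
  have hE := dataNormST_nonneg hq hD hZ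
  set E := dataNormST (Zl.length + 1) γ R q₀ φ with hEd
  obtain ⟨j, q1, hq1, hjq⟩ := cover (x := ρ⁻¹ • x) (by
    rw [norm_smul, norm_inv, Real.norm_of_nonneg hρ0.le, ← hρ, inv_mul_cancel₀ hρ0.ne'])
  have hxe : x = ρ • sg j (om q1) := by
    rw [hjq, smul_smul, mul_inv_cancel₀ hρ0.ne', one_smul]
  set α := 2 + 2 * γ - 4 * (zeta Zl : ℝ) with hα
  have hF := Zop_contDiff Zl hφ
  set g : E3 → ℝ := fun x => Zop Zl φ (0, x) with hg
  have cdg : ContDiff ℝ 1 g := slice_contDiff hF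
  set H : Fin 3 → E3 → ℝ := fun i x => Zop (VF.pd i.succ :: Zl) φ (0, x) with hH
  have cH : ∀ i, Continuous (H i) := fun i => Zslice_cont _ hφ
  have cg : Continuous g := cdg.continuous
  set ch : ℝ × ℝ → E3 := fun q => ρ • sg j (om q) with hch
  have cdch : ContDiff ℝ 1 ch := ((sg j).contDiff.comp om_contDiff).const_smul ρ
  have cch := cdch.continuous
  set V : ℝ × ℝ → ℝ := fun q => |g (ch q)| + (|ρ * L * H 0 (ch q)| + |ρ * L * H 1 (ch q)| + |ρ * L * H 2 (ch q)|) with hV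
  have c0 := cH 0
  have c1 := cH 1
  have c2 := cH 2
  have cV : Continuous V := by fun_prop
  have V0 : ∀ q, 0 ≤ V q := fun q => by positivity
  have fdb : ∀ q ∈ Qs, |g (ch q)| ≤ V q ∧ ‖fderiv ℝ (fun q => g (ch q)) q‖ ≤ V q := by
    intro p hp
    have p0 := abs_nonneg (ρ * L * H 0 (ch p))
    have p1 := abs_nonneg (ρ * L * H 1 (ch p))
    have p2 := abs_nonneg (ρ * L * H 2 (ch p))
    constructor
    · simp only [hV]; linarith
    have e1 : fderiv ℝ (fun q => g (ch q)) p = (fderiv ℝ g (ch p)).comp (fderiv ℝ ch p) :=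
      fderiv_comp p (cdg.differentiable (by norm_num) _) (cdch.differentiable (by norm_num) _)
    have e2 : HasFDerivAt ch (ρ • ((sg j).toContinuousLinearEquiv.toContinuousLinearMap.comp (fderiv ℝ om p))) p := by
      have d := (om_contDiff (n := 1)).differentiable (by norm_num) p
      exact (((sg j).toContinuousLinearEquiv.hasFDerivAt).comp p d.hasFDerivAt).const_smul ρ
    have e3 : ‖fderiv ℝ ch p‖ ≤ ρ * L := by
      rw [e2.fderiv, norm_smul, Real.norm_of_nonneg hρ0.le]
      refine mul_le_mul_of_nonneg_left ?_ hρ0.le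
      apply ContinuousLinearMap.opNorm_le_bound _ L0
      intro v
      have : ‖(sg j) ((fderiv ℝ om p) v)‖ ≤ L * ‖v‖ := by
        rw [LinearIsometryEquiv.norm_map]
        exact ((fderiv ℝ om p).le_opNorm v).trans (mul_le_mul_of_nonneg_right (hL p hp) (norm_nonneg _))
      exact this
    rw [e1]
    refine (ContinuousLinearMap.opNorm_comp_le _ _).trans ?_
    have hs : ‖fderiv ℝ g (ch p)‖ ≤ |H 0 (ch p)| + |H 1 (ch p)| + |H 2 (ch p)| := by
      have := slice_coord hF (ch p)
      rw [Fin.sum_univ_three] at this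
      exact this
    have hm : ‖fderiv ℝ g (ch p)‖ * ‖fderiv ℝ ch p‖ ≤ (|H 0 (ch p)| + |H 1 (ch p)| + |H 2 (ch p)|) * (ρ * L) := by
      gcongr
    have ha : ∀ y : ℝ, |ρ * L * y| = |y| * (ρ * L) := fun y => by
      rw [abs_mul, abs_of_nonneg (by positivity : 0 ≤ ρ * L), mul_comm]
    simp only [hV, ha]
    have := abs_nonneg (g (ch p))
    linarith
  have hZn : Zl.length ≤ n := by omega
  have b0 : ρ ^ α * ∫ q, g (ch q) ^ 4 ∂mQ ≤ (C * E) ^ 2 := by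
    refine (hC Zl n hZn hn γ R q₀ φ g1 g2 hR hq hφ hD ρ hx j).trans ?_
    have m := dataNormST_mono hq hD hZ (show Zl.length ≤ Zl.length + 1 by omega)
    have m0 := dataNormST_nonneg hq hD hZn
    gcongr
  have bi : ∀ i, ρ ^ α * ∫ q, (ρ * L * H i (ch q)) ^ 4 ∂mQ ≤ L ^ 4 * (C * E) ^ 2 := by
    intro i
    have h1 := hC (VF.pd i.succ :: Zl) n (by simpa using hZ) hn γ R q₀ φ g1 g2 hR hq hφ hD ρ hx j
    have e1 : ρ ^ (2 + 2 * γ - 4 * (zeta (VF.pd i.succ :: Zl) : ℝ)) = ρ ^ α * ρ ^ 4 := by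
      rw [← Real.rpow_natCast ρ 4, ← Real.rpow_add hρ0]
      congr 1
      simp [zeta, VF.zeta, hα]; ring
    rw [e1] at h1
    have e2 : ∫ q, (ρ * L * H i (ch q)) ^ 4 ∂mQ = ρ ^ 4 * L ^ 4 * ∫ q, H i (ch q) ^ 4 ∂mQ := by
      rw [← integral_const_mul]
      congr 1
      funext q; ring
    rw [e2]
    have h2 : ρ ^ α * ρ ^ 4 * ∫ q, H i (ch q) ^ 4 ∂mQ ≤ (C * E) ^ 2 := h1
    have := mul_le_mul_of_nonneg_left h2 (by positivity : 0 ≤ L ^ 4)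
    linarith
  have bV : ρ ^ α * ∫ q, V q ^ 4 ∂mQ ≤ (8 * (1 + 2 * L ^ 2) * C * E) ^ 2 := by
    have i1 : ∫ q, V q ^ 4 ∂mQ ≤ ∫ q, 64 * (g (ch q) ^ 4 + ((ρ * L * H 0 (ch q)) ^ 4 + (ρ * L * H 1 (ch q)) ^ 4 + (ρ * L * H 2 (ch q)) ^ 4)) ∂mQ := by
      apply integral_mono (int_mQ (by fun_prop)) (int_mQ (by fun_prop))
      intro q
      exact four_pow _ _ _ _
    have ig : Integrable (fun q => g (ch q) ^ 4) mQ := int_mQ (by fun_prop)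
    have i00 : Integrable (fun q => (ρ * L * H 0 (ch q)) ^ 4) mQ := int_mQ (by fun_prop)
    have i01 : Integrable (fun q => (ρ * L * H 1 (ch q)) ^ 4) mQ := int_mQ (by fun_prop)
    have i02 : Integrable (fun q => (ρ * L * H 2 (ch q)) ^ 4) mQ := int_mQ (by fun_prop)
    rw [integral_const_mul, integral_add ig ((i00.fun_add i01).fun_add i02), integral_add (i00.fun_add i01) i02,
      integral_add i00 i01] at i1
    have i2 := mul_le_mul_of_nonneg_left i1 (by positivity : 0 ≤ ρ ^ α)
    have t0 := bi 0
    have t1 := bi 1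
    have t2 := bi 2
    have t3 : (8 * (1 + 2 * L ^ 2) * C * E) ^ 2 = 64 * ((C * E) ^ 2 + 3 * (L ^ 4 * (C * E) ^ 2)) + 64 * (L ^ 4 + 4 * L ^ 2) * (C * E) ^ 2 := by ring
    have t4 : 0 ≤ 64 * (L ^ 4 + 4 * L ^ 2) * (C * E) ^ 2 := by positivity
    rw [t3]
    linarith
  apply le_of_forall_pos_le_add
  intro ε hε
  set B := 8 * (1 + 2 * L ^ 2) * C * E with hB
  have hB0 : 0 ≤ B := by positivity
  set m := √(ρ ^ (-(1 + γ - 2 * (zeta Zl : ℝ))) * (B + ε / 25)) with hm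
  have hmp : 0 < m := Real.sqrt_pos.2 (by positivity)
  have hm2 : m ^ 2 = ρ ^ (-(1 + γ - 2 * (zeta Zl : ℝ))) * (B + ε / 25) := Real.sq_sqrt (by positivity)
  have hinv : ρ ^ (1 + γ - 2 * (zeta Zl : ℝ)) * ρ ^ (-(1 + γ - 2 * (zeta Zl : ℝ))) = 1 := by
    rw [← Real.rpow_add hρ0]; simp
  have hsq : ρ ^ α = (ρ ^ (1 + γ - 2 * (zeta Zl : ℝ))) ^ 2 := by
    rw [← Real.rpow_natCast, ← Real.rpow_mul hρ0.le]
    congr 1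
    rw [hα]; push_cast; ring
  have hmor := morrey (k := fun q => g (ch q)) (V := V) (cdg.comp cdch) cV V0 fdb hmp (by
    have a1 : ρ ^ α * m ^ 4 = (B + ε / 25) ^ 2 := by
      calc ρ ^ α * m ^ 4 = (ρ ^ (1 + γ - 2 * (zeta Zl : ℝ))) ^ 2 * (m ^ 2) ^ 2 := by rw [hsq]; ring
        _ = (ρ ^ (1 + γ - 2 * (zeta Zl : ℝ)) * ρ ^ (-(1 + γ - 2 * (zeta Zl : ℝ)))) ^ 2 * (B + ε / 25) ^ 2 := by
          rw [hm2]; ring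
        _ = _ := by rw [hinv]; ring
    have a2 : B ^ 2 ≤ (B + ε / 25) ^ 2 := by gcongr; linarith
    have a3 : 0 < ρ ^ α := by positivity
    refine le_of_mul_le_mul_left ?_ a3
    rw [a1]; exact bV.trans a2) hq1
  have hch1 : ch q1 = x := hxe.symm
  simp only [hch1] at hmor
  have f1 : g x ^ 2 ≤ 25 * m ^ 2 := by
    rw [← sq_abs (g x)]
    nlinarith [abs_nonneg (g x)]
  calc ρ ^ (1 + γ - 2 * (zeta Zl : ℝ)) * g x ^ 2
      ≤ ρ ^ (1 + γ - 2 * (zeta Zl : ℝ)) * (25 * m ^ 2) := by gcongr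
    _ = (ρ ^ (1 + γ - 2 * (zeta Zl : ℝ)) * ρ ^ (-(1 + γ - 2 * (zeta Zl : ℝ)))) * (25 * (B + ε / 25)) := by rw [hm2]; ring
    _ = _ := by rw [hinv, hB]; ring

lemma rstar_near {M r : ℝ} (hM : |M| ≤ 1 / 100) (hr : 1 ≤ r) : |rstar M r - r| ≤ r / 40 := by
  obtain ⟨h1, h2⟩ := abs_le.1 hM
  have p1 : 0 < 1 + M := by linarith
  have hy : 1 ≤ (r + M) / (1 + M) := by rw [le_div_iff₀ p1]; linarith
  have l0 : 0 ≤ Real.log ((r + M) / (1 + M)) := Real.log_nonneg hy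
  have l1 := Real.log_le_sub_one_of_pos (show 0 < (r + M) / (1 + M) by linarith)
  have l2 : (r + M) / (1 + M) - 1 ≤ 100 / 99 * r := by
    rw [sub_le_iff_le_add, div_le_iff₀ p1]
    nlinarith
  unfold rstar
  rw [abs_le]
  constructor <;> nlinarith

lemma rstar_lt {M r R : ℝ} (hM : |M| ≤ 1 / 100) (hr : 0 ≤ r) (hrR : r < R) (hR : 2 ≤ R) :
    rstar M r < rstar M R := by
  obtain ⟨h1, h2⟩ := abs_le.1 hM
  have p1 : 0 < 1 + M := by linarith
  have nR := abs_le.1 (rstar_near hM (show 1 ≤ R by linarith))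
  rcases le_or_gt 1 r with h | h
  · have pr : 0 < r + M := by linarith
    have pR : 0 < R + M := by linarith
    have e : Real.log ((R + M) / (1 + M)) - Real.log ((r + M) / (1 + M)) = Real.log ((R + M) / (r + M)) := by
      rw [Real.log_div pR.ne' p1.ne', Real.log_div pr.ne' p1.ne', Real.log_div pR.ne' pr.ne']
      ring
    have hy : 1 ≤ (R + M) / (r + M) := by rw [le_div_iff₀ pr]; linarith
    have l0 : 0 ≤ Real.log ((R + M) / (r + M)) := Real.log_nonneg hy
    have l1 := Real.log_le_sub_one_of_pos (show 0 < (R + M) / (r + M) by linarith)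
    have l2 : (R + M) / (r + M) - 1 ≤ 100 / 99 * (R - r) := by
      rw [sub_le_iff_le_add, div_le_iff₀ pr]
      nlinarith
    rw [← e] at l0 l1
    unfold rstar
    nlinarith
  · have goal : rstar M r ≤ 3 / 2 := by
      unfold rstar
      rcases le_or_gt M 0 with hm | hm
      · have : Real.log ((r + M) / (1 + M)) ≤ 0 := by
          rw [← Real.log_abs]
          apply Real.log_nonpos (abs_nonneg _)
          rw [abs_le]
          constructor
          · rw [le_div_iff₀ p1]; linarith
          · rw [div_le_iff₀ p1]; linarith
        nlinarith
      · have pr : 0 < r + M := by linarith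
        set z := (1 + M) / (r + M) with hz
        have hzp : 0 < z := by positivity
        have e : Real.log ((r + M) / (1 + M)) = - Real.log z := by
          rw [hz, ← Real.log_inv, inv_div]
        have t1 := Real.log_le_sub_one_of_pos (Real.sqrt_pos.2 hzp)
        rw [Real.log_sqrt hzp.le] at t1
        have t2 := Real.sq_sqrt hzp.le
        have t3 : M * z ≤ 1 + M := by
          rw [hz, mul_div_assoc', div_le_iff₀ pr]
          nlinarith
        have t4 := Real.sqrt_nonneg z
        have t5 : M * √z ≤ 11 / 100 := by
          apply abs_le_of_sq_le_sq' _ (by norm_num) |>.2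
          rw [mul_pow, t2]
          nlinarith
        rw [e]
        nlinarith
    linarith

lemma Sigma_sub {M R u₁ v₁ : ℝ} (hM : |M| ≤ 1 / 100) (hR : 2 ≤ R) (hu : u₁ ≤ u0 M R) :
    Sigma0 M u₁ v₁ ⊆ {x : E3 | R ≤ ‖x‖} := by
  intro x hx
  by_contra h
  have h' : ‖x‖ < R := not_le.1 h
  have h1 := rstar_lt hM (norm_nonneg x) h' hR
  have h2 := hx.2
  unfold u0 at hu
  linarith

lemma Sigma_meas (M u₁ v₁ : ℝ) : MeasurableSet (Sigma0 M u₁ v₁) := by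
  have : Measurable fun x : E3 => -rstar M ‖x‖ := by unfold rstar; fun_prop
  exact (measurableSet_le measurable_const this).inter (measurableSet_le this measurable_const)

lemma part_three : ∃ C : ℝ, 0 ≤ C ∧ ∀ (Zl : List VF) (n : ℕ), Zl.length ≤ n + 1 → n ≤ 3 →
    ∀ (γ R q₀ M : ℝ) (φ : Spt → ℝ),
    1 < γ → γ < 2 → 2 ≤ R → 0 ≤ q₀ → |M| ≤ 1 / 100 → ContDiff ℝ (⊤ : ℕ∞) φ → DataFiniteST n γ R q₀ φ →
    ∀ u₁ v₁ : ℝ, u₁ ≤ u0 M R →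
        (∫ x in Sigma0 M u₁ v₁, ‖x‖ ^ (-1 - 2 * (zeta Zl : ℝ)) * (Zop Zl φ (0, x)) ^ 2)
          ≤ C * (-u₁) ^ (-γ + 1) * dataNormST (Zl.length - 1) γ R q₀ φ := by
  obtain ⟨C, C0, hC⟩ := Zpoint
  refine ⟨2 * C, by positivity, ?_⟩
  intro Zl n hZ hn γ R q₀ M φ g1 g2 hR hq hM hφ hD u₁ v₁ hu
  have nR := abs_le.1 (rstar_near hM (show 1 ≤ R by linarith))
  have hu1 : 0 < -u₁ := by unfold u0 at hu; linarith
  have sub := Sigma_sub (v₁ := v₁) hM hR hu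
  obtain ⟨iD, eDe⟩ := eD_int hD (show Zl.length - 1 ≤ n by omega)
  set c := 2 * C * (-u₁) ^ (-γ + 1) with hc
  have hc0 : 0 ≤ c := by positivity
  rw [← eDe, ← integral_const_mul]
  calc ∫ x in Sigma0 M u₁ v₁, ‖x‖ ^ (-1 - 2 * (zeta Zl : ℝ)) * (Zop Zl φ (0, x)) ^ 2
      ≤ ∫ x in Sigma0 M u₁ v₁, c * eD (Zl.length - 1) γ q₀ φ x := by
        apply integral_mono_of_nonneg
        · exact Filter.Eventually.of_forall fun x => by positivity
        · exact (iD.mono_set sub).const_mul c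
        · refine ae_restrict_of_forall_mem (Sigma_meas _ _ _) fun x hx => ?_
          have hxR : R ≤ ‖x‖ := sub hx
          have hx0 : 0 < ‖x‖ := by linarith
          have nx := abs_le.1 (rstar_near hM (show 1 ≤ ‖x‖ by linarith))
          have a := hC Zl 0 (by omega) (by norm_num) γ q₀ φ g1 g2 hq hφ x (by linarith)
          simp only [norm_iteratedFDeriv_zero, Real.norm_eq_abs, sq_abs, Nat.cast_zero, mul_zero, add_zero] at a
          have b : ‖x‖ ^ (-γ + 1) ≤ 2 * (-u₁) ^ (-γ + 1) := by
            have b1 : ‖x‖ ^ (-γ + 1) ≤ (-u₁ / 2) ^ (-γ + 1) :=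
              Real.rpow_le_rpow_of_nonpos (by positivity) (by linarith [hx.2]) (by linarith)
            have b2 : (-u₁ / 2) ^ (-γ + 1) = 2 ^ (γ - 1) * (-u₁) ^ (-γ + 1) := by
              rw [Real.div_rpow hu1.le (by norm_num), div_eq_mul_inv, ← Real.rpow_neg (by norm_num), mul_comm]
              congr 2; ring
            have b3 : (2 : ℝ) ^ (γ - 1) ≤ 2 := by
              calc (2 : ℝ) ^ (γ - 1) ≤ 2 ^ (1 : ℝ) := Real.rpow_le_rpow_of_exponent_le (by norm_num) (by linarith)
                _ = 2 := by simp
            rw [b2] at b1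
            refine b1.trans ?_
            gcongr
          have e : ‖x‖ ^ (-1 - 2 * (zeta Zl : ℝ)) = ‖x‖ ^ (-γ + 1) * ‖x‖ ^ (γ - 2 - 2 * (zeta Zl : ℝ)) := by
            rw [← Real.rpow_add hx0]; congr 1; ring
          have hE := eD_nonneg (Zl.length - 1) γ hq φ x
          show ‖x‖ ^ (-1 - 2 * (zeta Zl : ℝ)) * (Zop Zl φ (0, x)) ^ 2 ≤ c * eD (Zl.length - 1) γ q₀ φ x
          rw [e, mul_assoc]
          calc ‖x‖ ^ (-γ + 1) * (‖x‖ ^ (γ - 2 - 2 * (zeta Zl : ℝ)) * (Zop Zl φ (0, x)) ^ 2)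
              ≤ (2 * (-u₁) ^ (-γ + 1)) * (C * eD (Zl.length - 1) γ q₀ φ x) := by
                apply mul_le_mul b a (by positivity) (by positivity)
            _ = _ := by rw [hc]; ring
    _ ≤ ∫ x in {x : E3 | R ≤ ‖x‖}, c * eD (Zl.length - 1) γ q₀ φ x := by
        apply setIntegral_mono_set (iD.const_mul _)
        · refine Filter.Eventually.of_forall fun x => ?_
          have := eD_nonneg (Zl.length - 1) γ hq φ x
          show 0 ≤ _
          positivity
        · exact sub.eventuallyLE

/-- final assembly -/
theorem initial_slice_aux :
    ∃ ε : ℝ, 0 < ε ∧ ∃ C : ℝ, 0 < C ∧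
    ∀ (γ₀ R q₀ M₀ : ℝ) (n : ℕ) (φ : Spt → ℝ),
      1 < γ₀ → γ₀ < 2 → 2 ≤ R → 0 ≤ q₀ → |M₀| ≤ ε → n ≤ 3 →
      ContDiff ℝ (⊤ : ℕ∞) φ → DataFiniteST n γ₀ R q₀ φ →
      ((∀ Zl : List VF, Zl.length ≤ n → ∀ ρ : ℝ, R ≤ ρ →
        sphI (fun ω => ρ ^ (1 + γ₀ - 2 * (zeta Zl : ℝ)) * (Zop Zl φ (0, ρ • ω)) ^ 2)
          ≤ C * dataNormST Zl.length γ₀ R q₀ φ) ∧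
      (∀ Zl : List VF, Zl.length ≤ n → ∀ ρ : ℝ, R ≤ ρ →
        sphI (fun ω => ρ ^ (2 + 2 * γ₀ - 4 * (zeta Zl : ℝ)) * (Zop Zl φ (0, ρ • ω)) ^ 4)
          ≤ C * (dataNormST Zl.length γ₀ R q₀ φ) ^ 2) ∧
      (∀ Zl : List VF, Zl.length ≤ n + 1 → ∀ u₁ v₁ : ℝ, -v₁ ≤ u₁ → u₁ ≤ u0 M₀ R →
        (∫ x in Sigma0 M₀ u₁ v₁, ‖x‖ ^ (-1 - 2 * (zeta Zl : ℝ)) * (Zop Zl φ (0, x)) ^ 2)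
          ≤ C * (-u₁) ^ (-γ₀ + 1) * dataNormST (Zl.length - 1) γ₀ R q₀ φ) ∧
      (∀ Zl : List VF, Zl.length + 1 ≤ n → ∀ x : E3, R ≤ ‖x‖ →
        ‖x‖ ^ 2 * (Zop Zl φ (0, x)) ^ 2
          ≤ C * (rstar M₀ ‖x‖) ^ (-γ₀ + 1 + 2 * (zeta Zl : ℝ))
              * dataNormST (Zl.length + 1) γ₀ R q₀ φ)) := by
  obtain ⟨C1, C10, h1⟩ := part_one
  obtain ⟨C2, C20, h2⟩ := part_two
  obtain ⟨C3, C30, h3⟩ := part_three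
  obtain ⟨C4, C40, h4⟩ := part_four
  refine ⟨1 / 100, by norm_num, C1 + C2 + C3 + 128 * C4 + 1, by positivity, ?_⟩
  intro γ₀ R q₀ M₀ n φ g1 g2 hR hq hM hn hφ hD
  refine ⟨fun Zl hZ ρ hρ => ?_, fun Zl hZ ρ hρ => ?_, fun Zl hZ u₁ v₁ _ hu => ?_, fun Zl hZ x hx => ?_⟩
  · have hE := dataNormST_nonneg hq hD hZ
    refine (h1 Zl n hZ hn γ₀ R q₀ φ g1 g2 hR hq hφ hD ρ hρ).trans ?_
    gcongr
    linarith
  · refine (h2 Zl n hZ hn γ₀ R q₀ φ g1 g2 hR hq hφ hD ρ hρ).trans ?_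
    gcongr
    linarith
  · have hE := dataNormST_nonneg hq hD (show Zl.length - 1 ≤ n by omega)
    refine (h3 Zl n hZ hn γ₀ R q₀ M₀ φ g1 g2 hR hq hM hφ hD u₁ v₁ hu).trans ?_
    have nR := abs_le.1 (rstar_near hM (show 1 ≤ R by linarith))
    have hu1 : 0 < -u₁ := by unfold u0 at hu; linarith
    gcongr
    linarith
  · have hE := dataNormST_nonneg hq hD hZ
    have b := h4 Zl n hZ hn γ₀ R q₀ φ g1 g2 hR hq hφ hD x hx
    have hx0 : 0 < ‖x‖ := by linarith
    have nx := abs_le.1 (rstar_near hM (show 1 ≤ ‖x‖ by linarith))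
    have hs0 : 0 < rstar M₀ ‖x‖ := by linarith
    have hz : (zeta Zl : ℝ) ≤ 0 := by exact_mod_cast zeta_nonpos Zl
    have hz2 : -(2 : ℝ) ≤ (zeta Zl : ℝ) := by
      have := zeta_ge Zl
      exact_mod_cast (show (-2 : ℤ) ≤ zeta Zl by omega)
    set a := -γ₀ + 1 + 2 * (zeta Zl : ℝ) with ha
    have c : ‖x‖ ^ a ≤ 128 * (rstar M₀ ‖x‖) ^ a := by
      have b1 : ‖x‖ ^ a ≤ (rstar M₀ ‖x‖ / 2) ^ a :=
        Real.rpow_le_rpow_of_nonpos (by positivity) (by linarith) (by linarith)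
      have b2 : (rstar M₀ ‖x‖ / 2) ^ a = 2 ^ (-a) * (rstar M₀ ‖x‖) ^ a := by
        rw [Real.div_rpow hs0.le (by norm_num), div_eq_mul_inv, ← Real.rpow_neg (by norm_num), mul_comm]
      have b3 : (2 : ℝ) ^ (-a) ≤ 128 := by
        calc (2 : ℝ) ^ (-a) ≤ 2 ^ (7 : ℝ) := Real.rpow_le_rpow_of_exponent_le (by norm_num) (by linarith)
          _ = 128 := by norm_num
      rw [b2] at b1
      refine b1.trans ?_
      gcongr
    have e : ‖x‖ ^ 2 = ‖x‖ ^ a * ‖x‖ ^ (1 + γ₀ - 2 * (zeta Zl : ℝ)) := by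
      rw [← Real.rpow_add hx0, ← Real.rpow_natCast]
      congr 1
      rw [ha]; push_cast; ring
    rw [e, mul_assoc]
    calc ‖x‖ ^ a * (‖x‖ ^ (1 + γ₀ - 2 * (zeta Zl : ℝ)) * (Zop Zl φ (0, x)) ^ 2)
        ≤ (128 * (rstar M₀ ‖x‖) ^ a) * (C4 * dataNormST (Zl.length + 1) γ₀ R q₀ φ) :=
          mul_le_mul c b (by positivity) (by positivity)
      _ = (128 * C4) * (rstar M₀ ‖x‖) ^ a * dataNormST (Zl.length + 1) γ₀ R q₀ φ := by ring
      _ ≤ _ := by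
        gcongr
        linarith

/-- estimates on the initial slice `{t = 0, r ≥ R}` for functions with finite
weighted data norm `𝓔_{n,γ₀}` (Proposition 6.23.4.18 of the paper). -/
theorem initial_slice_estimates :
    ∃ ε : ℝ, 0 < ε ∧ ∃ C : ℝ, 0 < C ∧
    ∀ (γ₀ R q₀ M₀ : ℝ) (n : ℕ) (φ : Spt → ℝ),
      1 < γ₀ → γ₀ < 2 → 2 ≤ R → 0 ≤ q₀ → |M₀| ≤ ε → n ≤ 3 →
      ContDiff ℝ (⊤ : ℕ∞) φ → DataFiniteST n γ₀ R q₀ φ →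
      -- (i)  ∫_{S_r} r^{1+γ₀−2ζ(Z^i)} |Z^{(i)}φ|² dω ≤ C 𝓔_{i,γ₀}
      ((∀ Zl : List VF, Zl.length ≤ n → ∀ ρ : ℝ, R ≤ ρ →
        sphI (fun ω => ρ ^ (1 + γ₀ - 2 * (zeta Zl : ℝ)) * (Zop Zl φ (0, ρ • ω)) ^ 2)
          ≤ C * dataNormST Zl.length γ₀ R q₀ φ) ∧
      -- (ii) ∫_{S_r} r^{2+2γ₀−4ζ(Z^i)} |Z^{(i)}φ|⁴ dω ≤ C 𝓔²_{i,γ₀}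
      (∀ Zl : List VF, Zl.length ≤ n → ∀ ρ : ℝ, R ≤ ρ →
        sphI (fun ω => ρ ^ (2 + 2 * γ₀ - 4 * (zeta Zl : ℝ)) * (Zop Zl φ (0, ρ • ω)) ^ 4)
          ≤ C * (dataNormST Zl.length γ₀ R q₀ φ) ^ 2) ∧
      -- (iii) ∫_{Σ₀^{u₁,ū₁}} r^{−1−2ζ(Z^i)}|Z^{(i)}φ|² dx ≤ C (u₁)₊^{−γ₀+1} 𝓔_{i−1,γ₀}
      (∀ Zl : List VF, Zl.length ≤ n + 1 → ∀ u₁ v₁ : ℝ, -v₁ ≤ u₁ → u₁ ≤ u0 M₀ R →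
        (∫ x in Sigma0 M₀ u₁ v₁, ‖x‖ ^ (-1 - 2 * (zeta Zl : ℝ)) * (Zop Zl φ (0, x)) ^ 2)
          ≤ C * (-u₁) ^ (-γ₀ + 1) * dataNormST (Zl.length - 1) γ₀ R q₀ φ) ∧
      -- (iv) r²|Z^{(i−1)}φ(u,−u,ω)|² ≤ C u₊^{−γ₀+1+2ζ(Z^{i−1})} 𝓔_{i,γ₀} on {t=0, r ≥ R}
      (∀ Zl : List VF, Zl.length + 1 ≤ n → ∀ x : E3, R ≤ ‖x‖ →
        ‖x‖ ^ 2 * (Zop Zl φ (0, x)) ^ 2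
          ≤ C * (rstar M₀ ‖x‖) ^ (-γ₀ + 1 + 2 * (zeta Zl : ℝ))
              * dataNormST (Zl.length + 1) γ₀ R q₀ φ)) := by
  exact initial_slice_aux

end ExtStab
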